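/- arXiv:1812.09098 — 2 statements merged into one kernel-verified Lean document; each statement's English description precedes it below -/
import Mathlib

section
/- Define A_n(t,q) = ∑_{π ∈ S_n} t^{exc(π)} q^{maj(π) - exc(π)}. Then for all n ≥ 1, A_n(t,-1) = (1+t)^m A_m(t) if n = 2m, and A_n(t,-1) = (1+t)^m A_{m+1}(t) if n = 2m+1, where A_k(t) is the classical Eulerian polynomial. -/
open Finset

/-- A permutation of `Fin n` viewed as a function `ℕ → ℕ` (0-based), identity outside. -/
def pf {n : ℕ} (π : Equiv.Perm (Fin n)) (i : ℕ) : ℕ :=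
  if h : i < n then (π ⟨i, h⟩ : ℕ) else i

/-- Number of descents. -/
def desN {n : ℕ} (π : Equiv.Perm (Fin n)) : ℕ :=
  ((range (n - 1)).filter (fun i => pf π (i + 1) < pf π i)).card

/-- Number of inversions. -/
def invN {n : ℕ} (π : Equiv.Perm (Fin n)) : ℕ :=
  (((range n) ×ˢ (range n)).filter (fun p => p.1 < p.2 ∧ pf π p.2 < pf π p.1)).card

/-- Number of excedances. -/
def excN {n : ℕ} (π : Equiv.Perm (Fin n)) : ℕ :=
  ((range n).filter (fun i => i < pf π i)).card

/-- Major index. -/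
def majN {n : ℕ} (π : Equiv.Perm (Fin n)) : ℕ :=
  ∑ i ∈ (range (n - 1)).filter (fun i => pf π (i + 1) < pf π i), (i + 1)

/-- Number of admissible inversions. -/
def aiN {n : ℕ} (π : Equiv.Perm (Fin n)) : ℕ :=
  (((range n) ×ˢ (range n)).filter (fun p => p.1 < p.2 ∧ pf π p.2 < pf π p.1 ∧
    ((0 < p.1 ∧ pf π (p.1 - 1) < pf π p.1) ∨ ∃ k < p.2, p.1 < k ∧ pf π p.1 < pf π k))).card

/-- The classical Eulerian polynomial `A_n(t) = ∑_{π ∈ S_n} t^{des π}`. -/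
def eulerPoly (R : Type*) [CommRing R] (n : ℕ) (t : R) : R :=
  ∑ π : Equiv.Perm (Fin n), t ^ desN π

/-- The (maj, exc) q-Eulerian polynomial `A_n(t,q)`. -/
def Aq (R : Type*) [CommRing R] (n : ℕ) (t q : R) : R :=
  ∑ π : Equiv.Perm (Fin n), t ^ excN π * q ^ (majN π - excN π)

/-- The Gaussian binomial coefficient (as a value at `q`), via the q-Pascal recurrence. -/
def gaussR {R : Type*} [CommRing R] (q : R) : ℕ → ℕ → R
  | _, 0 => 1
  | 0, _ + 1 => 0
  | n + 1, k + 1 => gaussR q n k + q ^ (k + 1) * gaussR q n (k + 1)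

/-- The q-binomial-Eulerian polynomial `Ã_n(t,q)`. -/
def Atilde (R : Type*) [CommRing R] (n : ℕ) (t q : R) : R :=
  1 + t * ∑ m ∈ Icc 1 n, gaussR q n m * Aq R m t q

/-- Membership in PRW: if the permutation has an ascent, then the first ascent
carries the smallest letter. -/
def isPRW {n : ℕ} (π : Equiv.Perm (Fin n)) : Prop :=
  ∀ i < n, i + 1 < n → pf π i < pf π (i + 1) →
    (∀ j < i, ¬ pf π j < pf π (j + 1)) → pf π i = 0

instance {n : ℕ} : DecidablePred (isPRW (n := n)) := fun _ => by
  unfold isPRW; infer_instance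

/-- 1-based entries with boundary convention `σ₀ = σ_{n+1} = +∞` (encoded as `n`). -/
def extv {n : ℕ} (π : Equiv.Perm (Fin n)) (i : ℕ) : ℕ :=
  if 1 ≤ i ∧ i ≤ n then pf π (i - 1) else n

/-- Number of non-initial double descents. -/
def ddN {n : ℕ} (π : Equiv.Perm (Fin n)) : ℕ :=
  ((Icc 2 n).filter (fun i => extv π (i + 1) < extv π i ∧ extv π i < extv π (i - 1))).card


lemma pf_lt {n : ℕ} (π : Equiv.Perm (Fin n)) {i : ℕ} (h : i < n) : pf π i < n := by
  simp [pf, h]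

lemma pf_inj {n : ℕ} (π : Equiv.Perm (Fin n)) {i k : ℕ} (hi : i < n) (hk : k < n)
    (h : pf π i = pf π k) : i = k := by
  simp only [pf, hi, hk, dif_pos] at h
  have := π.injective (Fin.ext h)
  simpa using this

/-! ### exc ≤ maj -/

lemma pf_le_of_noDesc {n : ℕ} (π : Equiv.Perm (Fin n)) (d : ℕ)
    (h : ∀ i, d ≤ i → i + 1 < n → ¬ pf π (i + 1) < pf π i) :
    ∀ k i, d ≤ i → i + k + 1 = n → pf π i ≤ i := by
  intro k
  induction k with
  | zero => intro i _ hi; have := pf_lt π (i := i) (by omega); omega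
  | succ k ih =>
    intro i hd hi
    have h1 := ih (i + 1) (by omega) (by omega)
    have h2 := h i hd (by omega)
    have h3 : pf π i ≠ pf π (i + 1) := fun e => by
      have := pf_inj π (by omega) (by omega) e
      omega
    omega

lemma exc_le_maj {n : ℕ} (π : Equiv.Perm (Fin n)) : excN π ≤ majN π := by
  have key : ∀ d, (∀ i, d ≤ i → i + 1 < n → ¬ pf π (i + 1) < pf π i) → excN π ≤ d := by
    intro d h
    calc excN π ≤ (range d).card := by
          apply card_le_card
          intro i hi
          simp only [mem_filter, mem_range] at hi ⊢
          by_contra hc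
          have := pf_le_of_noDesc π d h (n - 1 - i) i (by omega) (by omega)
          omega
      _ = d := by simp
  apply key
  intro i hi hin hd
  have : i + 1 ≤ majN π := by
    unfold majN
    exact single_le_sum (f := fun i => i + 1) (fun _ _ => Nat.zero_le _)
      (by simp only [mem_filter, mem_range]; exact ⟨by omega, hd⟩)
  omega

/-! ### The product weight -/

/-- Weight of the `j`-th pair. -/
def uW {R : Type*} [CommRing R] (t : R) (j a b : ℕ) : R :=
  (if 2 * j < a then -t else 1) * (if 2 * j + 1 < b then -t else 1) * (if b < a then -1 else 1)

/-- Product weight. -/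
def pW {R : Type*} [CommRing R] (t : R) (m : ℕ) {n : ℕ} (π : Equiv.Perm (Fin n)) : R :=
  ∏ j ∈ range m, uW t j (pf π (2 * j)) (pf π (2 * j + 1))

lemma prod_pairs {R : Type*} [CommRing R] (f : ℕ → R) (m : ℕ) :
    ∏ i ∈ range (2 * m), f i = ∏ j ∈ range m, (f (2 * j) * f (2 * j + 1)) := by
  induction m with
  | zero => simp
  | succ m ih =>
    rw [show 2 * (m + 1) = 2 * m + 1 + 1 by ring, prod_range_succ, prod_range_succ, ih,
      prod_range_succ]
    ring

lemma pow_exc_eq {R : Type*} [CommRing R] (x : R) {n : ℕ} (π : Equiv.Perm (Fin n)) :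
    x ^ excN π = ∏ i ∈ range n, (if i < pf π i then x else 1) := by
  rw [excN, prod_ite]; simp

lemma pow_exc_eq' {R : Type*} [CommRing R] (x : R) {n k : ℕ} (π : Equiv.Perm (Fin n))
    (h1 : k ≤ n) (h2 : n ≤ k + 1) :
    x ^ excN π = ∏ i ∈ range k, (if i < pf π i then x else 1) := by
  rw [pow_exc_eq]
  rcases (by omega : n = k ∨ n = k + 1) with h | h
  · rw [show range n = range k by rw [h]]
  · have := pf_lt π (i := k) (by omega)
    rw [show range n = range (k + 1) by rw [h], prod_range_succ, if_neg (by omega), mul_one]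

lemma neg_one_pow_maj {R : Type*} [CommRing R] {n m : ℕ} (π : Equiv.Perm (Fin n))
    (h1 : 2 * m ≤ n) (h2 : n ≤ 2 * m + 1) :
    (-1 : R) ^ majN π =
      ∏ i ∈ range (2 * m), (if pf π (i + 1) < pf π i then (-1 : R) ^ (i + 1) else 1) := by
  have h0 : (-1 : R) ^ majN π =
      ∏ i ∈ range (n - 1), (if pf π (i + 1) < pf π i then (-1 : R) ^ (i + 1) else 1) := by
    rw [majN, ← prod_pow_eq_pow_sum, prod_filter]
  rw [h0]
  rcases (by omega : n = 2 * m + 1 ∨ n = 2 * m) with h | h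
  · rw [show n - 1 = 2 * m by omega]
  · rcases m with _ | m
    · simp [h]
    · rw [show n - 1 = 2 * m + 1 by omega, show 2 * (m + 1) = (2 * m + 1) + 1 by ring,
        prod_range_succ _ (2 * m + 1)]
      have : (-1 : R) ^ (2 * m + 1 + 1) = 1 := Even.neg_one_pow ⟨m + 1, by ring⟩
      rw [this]; simp

lemma weight_eq {R : Type*} [CommRing R] (t : R) {n m : ℕ} (π : Equiv.Perm (Fin n))
    (h1 : 2 * m ≤ n) (h2 : n ≤ 2 * m + 1) :
    t ^ excN π * (-1) ^ (majN π - excN π) = pW t m π := by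
  have hs : (-1 : R) ^ (majN π - excN π) = (-1) ^ excN π * (-1) ^ majN π := by
    have h := exc_le_maj π
    obtain ⟨d, hd⟩ := Nat.exists_eq_add_of_le h
    rw [hd, Nat.add_sub_cancel_left, pow_add, ← mul_assoc, ← mul_pow]; simp
  rw [hs, ← mul_assoc, ← mul_pow, mul_neg_one, pow_exc_eq' _ π h1 h2, neg_one_pow_maj π h1 h2,
    prod_pairs, prod_pairs, ← prod_mul_distrib, pW]
  apply prod_congr rfl
  intro j _
  have e1 : (-1 : R) ^ (2 * j + 1) = -1 := Odd.neg_one_pow ⟨j, rfl⟩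
  have e2 : (-1 : R) ^ (2 * j + 1 + 1) = 1 := Even.neg_one_pow ⟨j + 1, by ring⟩
  rw [e1, e2, uW]; simp

/-! ### Swapping -/

/-- Swap the entries in positions `2j`, `2j+1`. -/
def sw {n : ℕ} (j : ℕ) (h : 2 * j + 1 < n) (π : Equiv.Perm (Fin n)) : Equiv.Perm (Fin n) :=
  π * Equiv.swap ⟨2 * j, by omega⟩ ⟨2 * j + 1, h⟩

lemma sw_sw {n : ℕ} (j : ℕ) (h : 2 * j + 1 < n) (π : Equiv.Perm (Fin n)) :
    sw j h (sw j h π) = π := by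
  simp [sw, mul_assoc]

lemma pf_sw_left {n : ℕ} (j : ℕ) (h : 2 * j + 1 < n) (π : Equiv.Perm (Fin n)) :
    pf (sw j h π) (2 * j) = pf π (2 * j + 1) := by
  have : 2 * j < n := by omega
  simp [pf, sw, h, this]

lemma pf_sw_right {n : ℕ} (j : ℕ) (h : 2 * j + 1 < n) (π : Equiv.Perm (Fin n)) :
    pf (sw j h π) (2 * j + 1) = pf π (2 * j) := by
  have : 2 * j < n := by omega
  simp [pf, sw, h, this]

lemma pf_sw_of_ne {n : ℕ} (j : ℕ) (h : 2 * j + 1 < n) (π : Equiv.Perm (Fin n)) (k : ℕ)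
    (h1 : k ≠ 2 * j) (h2 : k ≠ 2 * j + 1) : pf (sw j h π) k = pf π k := by
  unfold pf
  split_ifs with hk
  · rw [sw, Equiv.Perm.mul_apply, Equiv.swap_apply_of_ne_of_ne] <;>
      simpa [Fin.ext_iff]
  · rfl

lemma pW_sw {R : Type*} [CommRing R] (t c : R) {n m : ℕ} (j : ℕ) (h : 2 * j + 1 < n)
    (hj : j < m) (π : Equiv.Perm (Fin n))
    (hu : uW t j (pf π (2 * j + 1)) (pf π (2 * j)) =
      c * uW t j (pf π (2 * j)) (pf π (2 * j + 1))) :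
    pW t m (sw j h π) = c * pW t m π := by
  unfold pW
  rw [← mul_prod_erase _ _ (mem_range.2 hj), ← mul_prod_erase (range m) _ (mem_range.2 hj),
    pf_sw_left, pf_sw_right, hu, mul_assoc]
  congr 2
  apply prod_congr rfl
  intro i hi
  have hne := ne_of_mem_erase hi
  rw [pf_sw_of_ne _ _ _ _ (by omega) (by omega), pf_sw_of_ne _ _ _ _ (by omega) (by omega)]

/-- Permutations fixing the first `j` odd (0-based) positions. -/
def HH (n j : ℕ) : Finset (Equiv.Perm (Fin n)) :=
  univ.filter (fun π => ∀ i < j, pf π (2 * i + 1) = 2 * i + 1)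

lemma sw_mem_HH {n : ℕ} (j : ℕ) (h : 2 * j + 1 < n) (π : Equiv.Perm (Fin n)) (hπ : π ∈ HH n j) :
    sw j h π ∈ HH n j := by
  simp only [HH, mem_filter, mem_univ, true_and] at hπ ⊢
  intro i hi
  rw [pf_sw_of_ne _ _ _ _ (by omega) (by omega), hπ i hi]

lemma step {R : Type*} [CommRing R] (t : R) {n m : ℕ} (j : ℕ) (h : 2 * j + 1 < n) (hj : j < m) :
    ∑ π ∈ HH n j, pW t m π = (1 + t) * ∑ π ∈ HH n (j + 1), pW t m π := by
  have hH : HH n (j + 1) = (HH n j).filter (fun π => pf π (2 * j + 1) = 2 * j + 1) := by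
    ext π
    simp only [HH, mem_filter, mem_univ, true_and]
    constructor
    · intro hh; exact ⟨fun i hi => hh i (by omega), hh j (by omega)⟩
    · rintro ⟨ha, hb⟩ i hi
      rcases (by omega : i < j ∨ i = j) with h | rfl
      · exact ha i h
      · exact hb
  rw [← sum_filter_add_sum_filter_not (HH n j) (fun π => pf π (2 * j + 1) = 2 * j + 1),
    ← sum_filter_add_sum_filter_not ((HH n j).filter (fun π => ¬ pf π (2 * j + 1) = 2 * j + 1))
      (fun π => pf π (2 * j) = 2 * j + 1), ← hH]
  have hz : ∑ π ∈ ((HH n j).filter (fun π => ¬ pf π (2 * j + 1) = 2 * j + 1)).filter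
      (fun π => ¬ pf π (2 * j) = 2 * j + 1), pW t m π = 0 := by
    apply sum_involution (fun π _ => sw j h π)
    · intro π hπ
      simp only [mem_filter] at hπ
      have hne : pf π (2 * j) ≠ pf π (2 * j + 1) := fun e => by
        have := pf_inj π (by omega) (by omega) e
        omega
      rw [pW_sw t (-1) j h hj π]
      · ring
      · unfold uW
        split_ifs <;> first | omega | ring
    · intro π hπ _ e
      have h1 := pf_sw_left j h π
      rw [e] at h1
      have := pf_inj π (by omega) (by omega) h1
      omega
    · intro π hπ
      simp only [mem_filter] at hπ ⊢
      exact ⟨⟨sw_mem_HH j h π hπ.1.1, by rw [pf_sw_right]; exact hπ.2⟩,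
        by rw [pf_sw_left]; exact hπ.1.2⟩
    · intro π hπ
      exact sw_sw j h π
  have ht : ∑ π ∈ ((HH n j).filter (fun π => ¬ pf π (2 * j + 1) = 2 * j + 1)).filter
      (fun π => pf π (2 * j) = 2 * j + 1), pW t m π = t * ∑ π ∈ HH n (j + 1), pW t m π := by
    rw [mul_sum]
    symm
    rw [hH]
    apply sum_nbij' (sw j h) (sw j h)
    · intro π hπ
      simp only [mem_filter] at hπ ⊢
      refine ⟨⟨sw_mem_HH j h π hπ.1, ?_⟩, by rw [pf_sw_left]; exact hπ.2⟩
      rw [pf_sw_right]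
      intro e
      have := pf_inj π (by omega) (by omega) (e.trans hπ.2.symm)
      omega
    · intro π hπ
      simp only [mem_filter] at hπ ⊢
      exact ⟨sw_mem_HH j h π hπ.1.1, by rw [pf_sw_right]; exact hπ.2⟩
    · intro π _; exact sw_sw j h π
    · intro π _; exact sw_sw j h π
    · intro π hπ
      simp only [mem_filter] at hπ
      have hne : pf π (2 * j) ≠ pf π (2 * j + 1) := fun e => by
        have := pf_inj π (by omega) (by omega) e
        omega
      rw [pW_sw t t j h hj π]
      rw [hπ.2] at hne ⊢
      unfold uW
      split_ifs <;> first | omega | ring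
  rw [hz, ht]
  ring

lemma steps {R : Type*} [CommRing R] (t : R) {n m : ℕ} (h : 2 * m ≤ n) (j : ℕ) (hj : j ≤ m) :
    ∑ π : Equiv.Perm (Fin n), pW t m π = (1 + t) ^ j * ∑ π ∈ HH n j, pW t m π := by
  induction j with
  | zero => simp [HH]
  | succ j ih => rw [ih (by omega), step t j (by omega) (by omega)]; ring

/-- Index equivalence with even positions. -/
def evEquiv (n m : ℕ) (h1 : 2 * m ≤ n) (h2 : n ≤ 2 * m + 1) :
    Fin (n - m) ≃ {i : Fin n // (i : ℕ) % 2 = 0} where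
  toFun i := ⟨⟨2 * i, by omega⟩, by simp⟩
  invFun i := ⟨(i.1 : ℕ) / 2, by have := i.1.2; have := i.2; omega⟩
  left_inv i := by ext; simp
  right_inv i := by ext; have := i.2; simp; omega

lemma pf_ext_even {n m : ℕ} (h1 : 2 * m ≤ n) (h2 : n ≤ 2 * m + 1) (σ : Equiv.Perm (Fin (n - m)))
    (j : ℕ) (hj : j < m) : pf (σ.extendDomain (evEquiv n m h1 h2)) (2 * j) = 2 * pf σ j := by
  have a : 2 * j < n := by omega
  have b : j < n - m := by omega
  have := Equiv.Perm.extendDomain_apply_image σ (evEquiv n m h1 h2) ⟨j, b⟩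
  simp only [pf, a, b, dif_pos]
  exact congrArg Fin.val this

lemma pf_ext_odd {n m : ℕ} (h1 : 2 * m ≤ n) (h2 : n ≤ 2 * m + 1) (σ : Equiv.Perm (Fin (n - m)))
    (j : ℕ) (hj : j < m) : pf (σ.extendDomain (evEquiv n m h1 h2)) (2 * j + 1) = 2 * j + 1 := by
  have a : 2 * j + 1 < n := by omega
  have := Equiv.Perm.extendDomain_apply_not_subtype σ (evEquiv n m h1 h2)
    (b := ⟨2 * j + 1, a⟩) (by simp)
  simp only [pf, a, dif_pos]
  exact congrArg Fin.val this

lemma sum_HH {R : Type*} [CommRing R] (t : R) {n m : ℕ} (h1 : 2 * m ≤ n) (h2 : n ≤ 2 * m + 1) :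
    ∑ π ∈ HH n m, pW t m π = ∑ σ : Equiv.Perm (Fin (n - m)), t ^ excN σ := by
  symm
  apply sum_bij (fun σ _ => σ.extendDomain (evEquiv n m h1 h2))
  · intro σ _
    simp only [HH, mem_filter, mem_univ, true_and]
    exact fun i hi => pf_ext_odd h1 h2 σ i hi
  · intro σ _ τ _ e
    exact Equiv.Perm.extendDomainHom_injective (evEquiv n m h1 h2) e
  · intro π hπ
    simp only [HH, mem_filter, mem_univ, true_and] at hπ
    have hodd : ∀ i : Fin n, ¬ (i : ℕ) % 2 = 0 → π i = i := by
      intro i hi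
      have h3 := hπ ((i : ℕ) / 2) (by have := i.2; omega)
      have h4 : 2 * ((i : ℕ) / 2) + 1 = i := by omega
      rw [h4] at h3
      simp only [pf, i.2, dif_pos] at h3
      exact Fin.ext h3
    have hev : ∀ i : Fin n, ((π i : Fin n) : ℕ) % 2 = 0 ↔ (i : ℕ) % 2 = 0 := by
      intro i
      constructor
      · intro h; by_contra hc; rw [hodd i hc] at h; exact hc h
      · intro h
        by_contra hc
        have := π.injective (hodd _ hc)
        rw [this] at hc
        exact hc h
    refine ⟨(evEquiv n m h1 h2).permCongr.symm (π.subtypePerm hev), mem_univ _, ?_⟩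
    ext i
    by_cases hi : (i : ℕ) % 2 = 0
    · rw [Equiv.Perm.extendDomain_apply_subtype _ (evEquiv n m h1 h2) (b := i) hi]
      simp [Equiv.permCongr_symm]
    · rw [Equiv.Perm.extendDomain_apply_not_subtype _ (evEquiv n m h1 h2) (b := i) hi, hodd i hi]
  · intro σ _
    rw [pow_exc_eq' t σ (k := m) (by omega) (by omega), pW]
    apply prod_congr rfl
    intro j hj
    rw [mem_range] at hj
    rw [pf_ext_even h1 h2 σ j hj, pf_ext_odd h1 h2 σ j hj, uW]
    split_ifs <;> first | omega | ring

/-! ### exc and des are equidistributed -/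

lemma sum_ite_card {R : Type*} [CommRing R] (n : ℕ) (P : ℕ → Prop) [DecidablePred P] (a b : R) :
    ∑ i ∈ range n, (if P i then a else b) =
      (((range n).filter P).card : R) * a + ((n : R) - (((range n).filter P).card : R)) * b := by
  rw [sum_ite]
  have := card_filter_add_card_filter_not (s := range n) P
  rw [card_range] at this
  have h : (n : R) = (((range n).filter P).card : R) +
    (((range n).filter (fun i => ¬ P i)).card : R) := by
    rw [← Nat.cast_add, this]
  simp only [sum_const, nsmul_eq_mul]
  rw [h]; ring

/-- Transfer operator. -/
def gT {R : Type*} [CommRing R] (n : ℕ) (f : ℕ → R) (k : ℕ) : R :=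
  f k + ((k : R) * f k + ((n : R) - (k : R)) * f (k + 1))

lemma excN_eq_sum {n : ℕ} (π : Equiv.Perm (Fin n)) :
    excN π = ∑ i : Fin n, if i < π i then 1 else 0 := by
  rw [excN, card_filter, sum_range]
  apply sum_congr rfl
  intro i _
  simp only [pf, i.2, dif_pos, Fin.lt_def, Fin.eta]

lemma exc_rec {R : Type*} [CommRing R] (n : ℕ) (f : ℕ → R) :
    ∑ π : Equiv.Perm (Fin (n + 1)), f (excN π) = ∑ σ : Equiv.Perm (Fin n), gT n f (excN σ) := by
  rw [← Equiv.sum_comp (Equiv.Perm.decomposeFin (n := n)).symm, Fintype.sum_prod_type_right]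
  apply sum_congr rfl
  intro σ _
  have h0 : excN (Equiv.Perm.decomposeFin.symm (0, σ)) = excN σ := by
    rw [excN_eq_sum, excN_eq_sum, Fin.sum_univ_succ]
    simp
  have hs : ∀ i : Fin n, excN (Equiv.Perm.decomposeFin.symm ((σ i).succ, σ)) =
      if i < σ i then excN σ else excN σ + 1 := by
    intro i
    rw [excN_eq_sum, excN_eq_sum, Fin.sum_univ_succ]
    rw [← add_sum_erase _ _ (mem_univ i), ← add_sum_erase univ _ (mem_univ i)]
    have : ∑ x ∈ univ.erase i, (if x.succ < (Equiv.Perm.decomposeFin.symm ((σ i).succ, σ)) x.succ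
        then 1 else 0) = ∑ x ∈ univ.erase i, (if x < σ x then 1 else 0) := by
      apply sum_congr rfl
      intro x hx
      have hx := ne_of_mem_erase hx
      rw [Equiv.Perm.decomposeFin_symm_apply_succ, Equiv.swap_apply_of_ne_of_ne]
      · simp
      · exact Fin.succ_ne_zero _
      · simpa using hx
    rw [this]
    simp
    split_ifs <;> omega
  rw [Fin.sum_univ_succ, h0, ← Equiv.sum_comp σ]
  simp only [hs]
  rw [gT]
  congr 1
  rw [excN, ← sum_ite_card, sum_range]
  apply sum_congr rfl
  intro i _
  simp only [apply_ite f, pf, i.2, dif_pos, Fin.lt_def, Fin.eta]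

/-- Insert the value `0` at position `p`. -/
def ins {n : ℕ} (x : Fin (n + 1) × Equiv.Perm (Fin n)) : Equiv.Perm (Fin (n + 1)) :=
  ((finSuccEquiv' x.1).trans (Equiv.optionCongr x.2)).trans (finSuccEquiv' 0).symm

lemma ins_self {n : ℕ} (p : Fin (n + 1)) (e : Equiv.Perm (Fin n)) : ins (p, e) p = 0 := by
  simp [ins]

lemma ins_succAbove {n : ℕ} (p : Fin (n + 1)) (e : Equiv.Perm (Fin n)) (i : Fin n) :
    ins (p, e) (p.succAbove i) = (e i).succ := by
  simp [ins]

lemma ins_bij (n : ℕ) : Function.Bijective (ins (n := n)) := by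
  rw [Fintype.bijective_iff_injective_and_card]
  constructor
  · rintro ⟨p, e⟩ ⟨p', e'⟩ h
    have hp : p = p' := by
      apply (ins (p', e')).injective
      rw [ins_self, ← h, ins_self]
    subst hp
    congr 1
    ext i
    have h1 := ins_succAbove p e i
    rw [h, ins_succAbove] at h1
    rw [Fin.succ_injective _ h1]
  · simp [Fintype.card_perm, Nat.factorial_succ]

lemma pf_ins_lt {n : ℕ} (p : Fin (n + 1)) (e : Equiv.Perm (Fin n)) (j : ℕ) (h : j < p) :
    pf (ins (p, e)) j = pf e j + 1 := by
  have hn : j < n := by omega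
  have := ins_succAbove p e ⟨j, hn⟩
  rw [Fin.succAbove_of_castSucc_lt _ _ (by simpa [Fin.lt_def] using h)] at this
  simp only [pf, hn, show j < n + 1 by omega, dif_pos]
  exact congrArg Fin.val this

lemma pf_ins_self {n : ℕ} (p : Fin (n + 1)) (e : Equiv.Perm (Fin n)) :
    pf (ins (p, e)) p = 0 := by
  simp only [pf, p.2, dif_pos, Fin.eta, ins_self, Fin.val_zero]

lemma pf_ins_gt {n : ℕ} (p : Fin (n + 1)) (e : Equiv.Perm (Fin n)) (j : ℕ) (h : p ≤ j)
    (hn : j < n) : pf (ins (p, e)) (j + 1) = pf e j + 1 := by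
  have := ins_succAbove p e ⟨j, hn⟩
  rw [Fin.succAbove_of_le_castSucc _ _ (by simpa [Fin.le_def] using h)] at this
  simp only [pf, hn, show j + 1 < n + 1 by omega, dif_pos]
  exact congrArg Fin.val this

lemma desN_eq_sum {n : ℕ} (π : Equiv.Perm (Fin (n + 1))) :
    desN π = ∑ i ∈ range n, if pf π (i + 1) < pf π i then 1 else 0 := by
  rw [desN, card_filter]; rfl

lemma des_ins_zero {n : ℕ} (e : Equiv.Perm (Fin n)) : desN (ins (0, e)) = desN e := by
  rw [desN_eq_sum]
  rcases n with _ | n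
  · simp [desN]
  · rw [desN_eq_sum, sum_range_succ']
    have h0 : pf (ins ((0 : Fin (n + 2)), e)) 0 = 0 := pf_ins_self 0 e
    simp only [h0]
    simp only [Nat.not_lt_zero, if_false, add_zero]
    apply sum_congr rfl
    intro i hi
    rw [mem_range] at hi
    rw [pf_ins_gt _ _ _ (by simp) (by omega), pf_ins_gt _ _ _ (by simp) (by omega)]
    simp

lemma des_ins_succ {n : ℕ} (e : Equiv.Perm (Fin n)) (i : Fin n) :
    desN (ins (i.succ, e)) =
      if (i : ℕ) + 1 < n ∧ pf e (i + 1) < pf e i then desN e else desN e + 1 := by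
  rcases n with _ | n
  · exact i.elim0
  rw [desN_eq_sum, desN_eq_sum]
  obtain ⟨p, hp⟩ := i
  have hL : ∀ j ≤ p, pf (ins ((⟨p, hp⟩ : Fin (n + 1)).succ, e)) j = pf e j + 1 :=
    fun j hj => pf_ins_lt _ _ _ (by simp; omega)
  have hS : pf (ins ((⟨p, hp⟩ : Fin (n + 1)).succ, e)) (p + 1) = 0 := pf_ins_self _ e
  have hG : ∀ j, p + 1 ≤ j → j < n + 1 →
      pf (ins ((⟨p, hp⟩ : Fin (n + 1)).succ, e)) (j + 1) = pf e j + 1 :=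
    fun j hj h => pf_ins_gt _ _ _ (by simpa using hj) h
  generalize pf (ins ((⟨p, hp⟩ : Fin (n + 1)).succ, e)) = F at hL hS hG
  generalize pf e = E at hL hG
  simp only
  have first : ∑ j ∈ range p, (if F (j + 1) < F j then 1 else 0) =
      ∑ j ∈ range p, (if E (j + 1) < E j then 1 else 0) := by
    apply sum_congr rfl
    intro j hj
    rw [mem_range] at hj
    rw [hL _ (by omega), hL _ (by omega)]; simp
  rcases (by omega : p = n ∨ p < n) with rfl | hlt
  · rw [sum_range_succ, first, hS, hL _ le_rfl]
    simp
  · obtain ⟨d, rfl⟩ : ∃ d, n = p + (d + 1) := ⟨n - p - 1, by omega⟩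
    rw [show range (p + (d + 1) + 1) = range (p + (d + 2)) from rfl, sum_range_add,
      sum_range_add _ p (d + 1),
      first, sum_range_succ' _ (d + 1), sum_range_succ' _ d, sum_range_succ' _ d]
    have rest : ∑ k ∈ range d, (if F (p + (k + 1 + 1) + 1) < F (p + (k + 1 + 1)) then 1 else 0) =
        ∑ k ∈ range d, (if E (p + (k + 1) + 1) < E (p + (k + 1)) then 1 else 0) := by
      apply sum_congr rfl
      intro k hk
      rw [mem_range] at hk
      rw [hG _ (by omega) (by omega), show p + (k + 1 + 1) = p + (k + 1) + 1 by ring,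
        hG (p + (k + 1)) (by omega) (by omega)]
      simp
    rw [rest]
    simp only [add_zero, zero_add, hS, hL p le_rfl]
    simp only [Nat.not_lt_zero, if_false]
    split_ifs <;> omega

lemma des_rec {R : Type*} [CommRing R] (n : ℕ) (f : ℕ → R) :
    ∑ π : Equiv.Perm (Fin (n + 1)), f (desN π) = ∑ σ : Equiv.Perm (Fin n), gT n f (desN σ) := by
  rw [← Equiv.sum_comp (Equiv.ofBijective _ (ins_bij n)), Fintype.sum_prod_type_right]
  apply sum_congr rfl
  intro σ _
  simp only [Equiv.ofBijective_apply]
  rw [Fin.sum_univ_succ, des_ins_zero, gT]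
  congr 1
  simp only [des_ins_succ]
  have hd : desN σ =
      ((range n).filter (fun i => i + 1 < n ∧ pf σ (i + 1) < pf σ i)).card := by
    rw [desN]
    congr 1
    ext i
    simp only [mem_filter, mem_range]
    constructor
    · rintro ⟨a, b⟩; exact ⟨by omega, by omega, b⟩
    · rintro ⟨a, b, c⟩; exact ⟨by omega, c⟩
  have key := sum_ite_card n (fun i => i + 1 < n ∧ pf σ (i + 1) < pf σ i)
    (f (desN σ)) (f (desN σ + 1))
  rw [← hd, sum_range] at key
  rw [← key]
  apply sum_congr rfl
  intro i _
  rw [apply_ite f]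

lemma exc_des {R : Type*} [CommRing R] (n : ℕ) : ∀ f : ℕ → R,
    ∑ π : Equiv.Perm (Fin n), f (excN π) = ∑ π : Equiv.Perm (Fin n), f (desN π) := by
  induction n with
  | zero => intro f; simp [excN, desN]
  | succ n ih => intro f; rw [exc_rec, des_rec, ih]

lemma main_eq {R : Type*} [CommRing R] (t : R) {n m : ℕ} (h1 : 2 * m ≤ n) (h2 : n ≤ 2 * m + 1) :
    Aq R n t (-1) = (1 + t) ^ m * eulerPoly R (n - m) t := by
  rw [Aq, eulerPoly, ← exc_des (n - m) (fun k => t ^ k), ← sum_HH t h1 h2,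
    ← steps t h1 m le_rfl]
  exact sum_congr rfl fun π _ => weight_eq t π h1 h2

/-- sign-balance of the (maj, exc)-q-Eulerian polynomials at q = -1. -/
theorem stmt6 {R : Type*} [CommRing R] (t : R) (n m : ℕ) (hn : 1 ≤ n) :
    (n = 2 * m → Aq R n t (-1) = (1 + t) ^ m * eulerPoly R m t) ∧
    (n = 2 * m + 1 → Aq R n t (-1) = (1 + t) ^ m * eulerPoly R (m + 1) t) := by
  constructor
  · intro h
    rw [main_eq t (m := m) (by omega) (by omega), show n - m = m by omega]
  · intro h
    rw [main_eq t (m := m) (by omega) (by omega), show n - m = m + 1 by omega]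
end

section
/- The q-binomial-Eulerian polynomials Ã_n(t,q) satisfy the quadratic recurrence Ã_{n+1}(t,q) = (1+t) Ã_n(t,q) + t ∑_{k=1}^n [n choose k]_q q^k A_k(t,q) Ã_{n-k}(t,q) for n ≥ 0, with Ã_0(t,q) = 1. -/
open Finset

/-- linear form -/
noncomputable def Lp {R : Type*} [CommRing R] {N : ℕ} (t : R) (j : Fin N) : MvPolynomial (Fin N) R :=
  ∑ k : Fin N, MvPolynomial.C ((if k ≤ j then t else 0) + (if j ≤ k then 1 else 0)) * MvPolynomial.X k

noncomputable def Mp {R : Type*} [CommRing R] {N : ℕ} (t : R) (i : ℕ) : MvPolynomial (Fin N) R :=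
  ∑ k : Fin N, MvPolynomial.C (if (k : ℕ) < i then t else 1) * MvPolynomial.X k

lemma Lp_sub_t {R : Type*} [CommRing R] {N : ℕ} (t : R) (j : Fin N) :
    Lp t j - MvPolynomial.C t * MvPolynomial.X j = Mp t (j : ℕ) := by
  unfold Lp Mp
  rw [← Finset.sum_erase_add _ _ (Finset.mem_univ j), ← Finset.sum_erase_add (a := j) _ _ (Finset.mem_univ j)]
  have : ∀ k ∈ (univ : Finset (Fin N)).erase j, (MvPolynomial.C ((if k ≤ j then t else 0) + (if j ≤ k then 1 else 0)) * MvPolynomial.X k : MvPolynomial (Fin N) R) = MvPolynomial.C (if (k : ℕ) < j then t else 1) * MvPolynomial.X k := by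
    intro k hk
    have hk' : k ≠ j := by simpa using hk
    congr 2
    rcases lt_or_gt_of_ne hk' with h | h
    · simp [h, h.le, not_le.2 h, Fin.lt_def.1 h]
    · simp [h, h.le, not_le.2 h, not_lt.2 (Fin.lt_def.1 h).le]
  rw [Finset.sum_congr rfl this]
  simp [add_mul]

lemma Lp_sub_one {R : Type*} [CommRing R] {N : ℕ} (t : R) (j : Fin N) :
    Lp t j - MvPolynomial.C 1 * MvPolynomial.X j = Mp t ((j : ℕ) + 1) := by
  unfold Lp Mp
  rw [← Finset.sum_erase_add _ _ (Finset.mem_univ j), ← Finset.sum_erase_add (a := j) _ _ (Finset.mem_univ j)]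
  have : ∀ k ∈ (univ : Finset (Fin N)).erase j, (MvPolynomial.C ((if k ≤ j then t else 0) + (if j ≤ k then 1 else 0)) * MvPolynomial.X k : MvPolynomial (Fin N) R) = MvPolynomial.C (if (k : ℕ) < j + 1 then t else 1) * MvPolynomial.X k := by
    intro k hk
    have hk' : k ≠ j := by simpa using hk
    congr 2
    rcases lt_or_gt_of_ne hk' with h | h
    · simp [h, h.le, not_le.2 h, Nat.lt_succ_of_lt (Fin.lt_def.1 h)]
    · have := Fin.lt_def.1 h
      simp [h, h.le, not_le.2 h, show ¬ ((k : ℕ) < j + 1) by omega]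
  rw [Finset.sum_congr rfl this]
  simp [add_mul]
  ring

noncomputable def gp {R : Type*} [CommRing R] {N : ℕ} (t u : R) (j : Fin N) (i : ℕ) : MvPolynomial (Fin N) R :=
  if i = 0 then 1 else (Lp t j - MvPolynomial.C u * MvPolynomial.X j) * Lp t j ^ (i - 1)

noncomputable def Gc {R : Type*} [CommRing R] {N : ℕ} (t u : R) (m : Fin N →₀ ℕ) : R :=
  MvPolynomial.coeff m (∏ j, gp t u j (m j))

noncomputable def Pc {R : Type*} [CommRing R] {N : ℕ} (t : R) (m : Fin N →₀ ℕ) : R :=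
  MvPolynomial.coeff m (∏ j, Lp t j ^ (m j))

lemma gp_sum {R : Type*} [CommRing R] {N : ℕ} (t u : R) (j : Fin N) (n : ℕ) :
    Lp t j ^ n = ∑ i ∈ range (n + 1), (MvPolynomial.C u * MvPolynomial.X j) ^ (n - i) * gp t u j i := by
  induction n with
  | zero => simp [gp]
  | succ n ih =>
    rw [Finset.sum_range_succ]
    have : ∀ i ∈ range (n + 1), (MvPolynomial.C u * MvPolynomial.X j) ^ (n + 1 - i) * gp t u j i =
      (MvPolynomial.C u * MvPolynomial.X j) * ((MvPolynomial.C u * MvPolynomial.X j) ^ (n - i) * gp t u j i) := by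
      intro i hi
      have : i < n + 1 := by simpa using hi
      rw [show n + 1 - i = (n - i) + 1 by omega]; ring
    rw [Finset.sum_congr rfl this, ← Finset.mul_sum, ← ih]
    simp [gp]; ring

lemma Pc_eq {R : Type*} [CommRing R] {N : ℕ} (t u : R) (m : Fin N →₀ ℕ) :
    Pc t m = ∑ p ∈ antidiagonal m, u ^ (∑ j, p.1 j) * Gc t u p.2 := by
  unfold Pc
  rw [Finset.prod_congr rfl (fun j _ => gp_sum t u j (m j)), Finset.prod_univ_sum, MvPolynomial.coeff_sum]
  refine Finset.sum_bij' (fun f _ => (m - Finsupp.equivFunOnFinite.symm f, Finsupp.equivFunOnFinite.symm f)) (fun p _ => p.2) ?_ ?_ ?_ ?_ ?_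
  · intro f hf
    rw [Finset.HasAntidiagonal.mem_antidiagonal]
    ext j
    have := (Fintype.mem_piFinset.1 hf) j
    simp at this ⊢
    omega
  · intro p hp
    rw [Finset.HasAntidiagonal.mem_antidiagonal] at hp
    rw [Fintype.mem_piFinset]
    intro j
    rw [← hp]; simp
  · intro f hf; ext; simp
  · intro p hp
    rw [Finset.HasAntidiagonal.mem_antidiagonal] at hp
    ext j <;> simp [← hp]
  · intro f hf
    set g : Fin N →₀ ℕ := Finsupp.equivFunOnFinite.symm f with hg
    have hfg : ∀ j, f j = g j := fun j => by simp [hg]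
    have hle : g ≤ m := by
      intro j
      have := (Fintype.mem_piFinset.1 hf) j
      simp at this
      rw [← hfg]; omega
    rw [Finset.prod_mul_distrib]
    have h1 : (∏ j, (MvPolynomial.C u * MvPolynomial.X j) ^ (m j - f j) : MvPolynomial (Fin N) R) =
      MvPolynomial.monomial (m - g) (u ^ (∑ j, (m - g) j)) := by
      simp only [mul_pow, Finset.prod_mul_distrib]
      rw [MvPolynomial.monomial_eq, Finsupp.prod_fintype _ _ (by simp), map_pow, Finset.prod_pow_eq_pow_sum]
      simp [hfg]
    rw [h1]
    conv_lhs => rw [show m = (m - g) + g from (tsub_add_cancel_of_le hle).symm]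
    simp only [tsub_add_cancel_of_le hle]
    rw [show MvPolynomial.coeff m = MvPolynomial.coeff ((m - g) + g) by rw [tsub_add_cancel_of_le hle], MvPolynomial.coeff_monomial_mul]
    simp only [Gc, hfg]

noncomputable def phiM {R : Type*} [CommRing R] {N : ℕ} (m : Fin N →₀ ℕ) : MvPolynomial (Fin N) R →ₐ[R] MvPolynomial (Fin N) R :=
  MvPolynomial.aeval (fun k => if m k = 0 then 0 else MvPolynomial.X k)

lemma coeff_phiM {R : Type*} [CommRing R] {N : ℕ} (m : Fin N →₀ ℕ) (p : MvPolynomial (Fin N) R) :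
    MvPolynomial.coeff m (phiM m p) = MvPolynomial.coeff m p := by
  induction p using MvPolynomial.induction_on' with
  | add p q hp hq => simp [hp, hq]
  | monomial d c =>
    by_cases h : ∃ k, d k ≠ 0 ∧ m k = 0
    · obtain ⟨k, hk, hm⟩ := h
      have h1 : phiM m (MvPolynomial.monomial d c) = 0 := by
        unfold phiM
        rw [MvPolynomial.aeval_monomial, Finsupp.prod_fintype _ _ (by simp), Finset.prod_eq_zero (Finset.mem_univ k) (by simp [hm, hk]), mul_zero]
      have h2 : d ≠ m := by rintro rfl; exact hk hm
      rw [h1, MvPolynomial.coeff_monomial, if_neg h2]; simp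
    · push Not at h
      have h1 : phiM m (MvPolynomial.monomial d c) = MvPolynomial.monomial d c := by
        unfold phiM
        rw [MvPolynomial.aeval_monomial, MvPolynomial.monomial_eq, Finsupp.prod_fintype _ _ (by simp), Finsupp.prod_fintype _ _ (by simp)]
        congr 1
        refine Finset.prod_congr rfl fun k _ => ?_
        by_cases hd : d k = 0
        · simp [hd]
        · simp [h k hd]
      rw [h1]

lemma phiM_tele {R : Type*} [CommRing R] {N : ℕ} (t : R) (m : Fin N →₀ ℕ) (mm : ℕ → ℕ) (hmm : ∀ j : Fin N, mm j = m j) (i : ℕ) (hi : i ≤ N) :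
    phiM m (Mp t 0) * ∏ j ∈ range i, (if mm j = 0 then 1 else phiM m (Mp t (j + 1))) =
    phiM m (Mp t i) * ∏ j ∈ range i, (if mm j = 0 then 1 else phiM m (Mp t j)) := by
  induction i with
  | zero => simp
  | succ i ih =>
    rw [Finset.prod_range_succ, Finset.prod_range_succ, ← mul_assoc, ih (by omega)]
    by_cases h : mm i = 0
    · have : phiM m (Mp t i) = phiM m (Mp t (i + 1)) := by
        unfold Mp
        rw [map_sum, map_sum]
        refine Finset.sum_congr rfl fun k _ => ?_
        by_cases hk : (k : ℕ) = i
        · have : m k = 0 := by rw [← hmm, hk, h]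
          simp [phiM, this]
        · have : (k : ℕ) < i ↔ (k : ℕ) < i + 1 := by omega
          simp only [this]
      rw [this]; simp [h]
    · simp [h]; ring

lemma Gc_zero {R : Type*} [CommRing R] {N : ℕ} (t u : R) : Gc t u (0 : Fin N →₀ ℕ) = 1 := by
  simp [Gc, gp]

lemma Gc_one {R : Type*} [CommRing R] [IsDomain R] {N : ℕ} (t : R) (m : Fin N →₀ ℕ) (hm : m ≠ 0) :
    Gc t 1 m = t * Gc t t m := by
  let mm : ℕ → ℕ := fun j => if h : j < N then m ⟨j, h⟩ else 0
  have hmm : ∀ j : Fin N, mm j = m j := fun j => by simp [mm]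
  have key := phiM_tele t m mm hmm N le_rfl
  rw [← Fin.prod_univ_eq_prod_range (fun j => (if mm j = 0 then 1 else phiM m (Mp t (j + 1)))),
    ← Fin.prod_univ_eq_prod_range (fun j => (if mm j = 0 then 1 else phiM m (Mp t j)))] at key
  simp only [hmm] at key
  have h0 : phiM m (Mp t 0) ≠ (0 : MvPolynomial (Fin N) R) := by
    obtain ⟨k, hk⟩ : ∃ k, m k ≠ 0 := by
      by_contra h; push Not at h; exact hm (Finsupp.ext h)
    intro h
    have := congrArg (MvPolynomial.coeff (Finsupp.single k 1)) h
    simp [phiM, Mp, apply_ite, MvPolynomial.coeff_sum, MvPolynomial.coeff_X] at this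
    rw [Finset.sum_eq_single k] at this
    · simp [hk] at this
    · intro b _ hb
      have : ¬ (Finsupp.single b 1 = Finsupp.single k 1) := by
        intro h; exact hb (Finsupp.single_left_injective one_ne_zero h)
      simp [MvPolynomial.coeff_X, this]
    · simp
  have hN : phiM m (Mp t N) = MvPolynomial.C t * phiM m (Mp t 0 : MvPolynomial (Fin N) R) := by
    have : (Mp t N : MvPolynomial (Fin N) R) = MvPolynomial.C t * Mp t 0 := by
      simp [Mp, Finset.mul_sum]
    rw [this, map_mul]; congr 1; simp [phiM]
  rw [hN, mul_comm (MvPolynomial.C t), mul_assoc] at key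
  have key2 := mul_left_cancel₀ h0 key
  unfold Gc
  rw [← coeff_phiM m (∏ j, gp t 1 j (m j)), ← coeff_phiM m (∏ j, gp t t j (m j)), ← MvPolynomial.coeff_C_mul]
  congr 1
  have e : ∀ (u : R) (f : ℕ → ℕ) (hf : ∀ j : Fin N, Lp t j - MvPolynomial.C u * MvPolynomial.X j = Mp t (f j)), phiM m (∏ j, gp t u j (m j)) =
     (∏ j, if m j = 0 then 1 else phiM m (Mp t (f j))) * ∏ j, if m j = 0 then 1 else phiM m (Lp t j ^ (m j - 1)) := by
    intro u f hf
    rw [map_prod, ← Finset.prod_mul_distrib]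
    refine Finset.prod_congr rfl fun j _ => ?_
    unfold gp
    split_ifs <;> simp [hf]
  rw [e 1 (fun j => j + 1) (fun j => Lp_sub_one t j), e t (fun j => j) (fun j => Lp_sub_t t j), key2]
  ring

noncomputable def cont {n N : ℕ} (s : Fin n → Fin N) : Fin N →₀ ℕ := ∑ v, Finsupp.single (s v) 1

lemma cont_apply {n N : ℕ} (s : Fin n → Fin N) (k : Fin N) :
    cont s k = (univ.filter (fun v => s v = k)).card := by
  simp [cont, Finsupp.finsetSum_apply, Finsupp.single_apply]

lemma cont_toMultiset {n N : ℕ} (s : Fin n → Fin N) :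
    Finsupp.toMultiset (cont s) = (List.ofFn s : Multiset (Fin N)) := by
  simp only [cont, map_sum, Finsupp.toMultiset_single, one_smul]
  induction n with
  | zero => simp
  | succ n ih =>
    rw [Fin.sum_univ_succ, List.ofFn_succ, ih (fun i => s i.succ)]
    rfl

lemma cont_inj {n N : ℕ} (f g : Fin n → Fin N) (hf : Monotone f) (hg : Monotone g) (h : cont f = cont g) : f = g := by
  have h2 := congrArg Finsupp.toMultiset h
  rw [cont_toMultiset, cont_toMultiset] at h2
  have h3 : (List.ofFn f).Perm (List.ofFn g) := Multiset.coe_eq_coe.1 h2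
  exact List.ofFn_injective (List.Perm.eq_of_sortedLE (List.sortedLE_ofFn_iff.2 hf) (List.sortedLE_ofFn_iff.2 hg) h3)

lemma cont_comp_perm {n N : ℕ} (s : Fin n → Fin N) (σ : Equiv.Perm (Fin n)) : cont (s ∘ σ) = cont s := by
  unfold cont
  exact Equiv.sum_comp σ (fun v => Finsupp.single (s v) 1)

lemma cont_surj {n N : ℕ} (m : Fin N →₀ ℕ) (hm : ∑ j, m j = n) : ∃ s : Fin n → Fin N, Monotone s ∧ cont s = m := by
  have hc : (Finsupp.toMultiset m).toList.length = n := by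
    rw [Multiset.length_toList, Finsupp.card_toMultiset, ← hm, Finsupp.sum_fintype _ _ (by simp)]
    simp
  let s : Fin n → Fin N := fun i => (Finsupp.toMultiset m).toList.get (Fin.cast hc.symm i)
  refine ⟨s ∘ Tuple.sort s, Tuple.monotone_sort s, ?_⟩
  rw [cont_comp_perm]
  refine Multiset.toFinsupp.symm.injective ?_
  change Finsupp.toMultiset _ = Finsupp.toMultiset _
  rw [cont_toMultiset]
  have : List.ofFn s = (Finsupp.toMultiset m).toList := by
    subst hc
    exact List.ofFn_get _
  rw [this, Multiset.coe_toList]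

def bkey {n : ℕ} (σ : Equiv.Perm (Fin n)) (i : Fin n) : ℕ := if i < σ i then (σ i : ℕ) else (σ i : ℕ) + n

def compat {n N : ℕ} (σ : Equiv.Perm (Fin n)) (s : Fin n → Fin N) : Prop :=
  Monotone s ∧ ∀ i j, i < j → s i = s j → bkey σ i < bkey σ j

def okW {n N : ℕ} (s : Fin n → Fin N) (v : Fin n) (x : Fin N × Bool) : Prop :=
  (x.2 = true → s v ≤ x.1) ∧ (x.2 = false → x.1 ≤ s v ∧ (x.1 = s v → ∃ u, u < v ∧ s u = s v))

/-- the colour word of a permutation -/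
def Wof {n N : ℕ} (s : Fin n → Fin N) (σ : Equiv.Perm (Fin n)) (v : Fin n) : Fin N × Bool :=
  (s (σ.symm v), decide (¬ σ.symm v < v))

lemma Wof_ok {n N : ℕ} (s : Fin n → Fin N) (hs : Monotone s) (σ : Equiv.Perm (Fin n)) (v : Fin n) : okW s v (Wof s σ v) := by
  constructor
  · intro h
    simp [Wof] at h ⊢
    exact hs h
  · intro h
    simp [Wof] at h ⊢
    exact ⟨hs h.le, fun h' => ⟨_, h, h'⟩⟩

lemma Wof_cont {n N : ℕ} (s : Fin n → Fin N) (σ : Equiv.Perm (Fin n)) : cont (fun v => (Wof s σ v).1) = cont s :=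
  cont_comp_perm s σ.symm

lemma sort_Wof {n N : ℕ} (s : Fin n → Fin N) (σ : Equiv.Perm (Fin n)) (h : compat σ s) :
    Tuple.sort (fun v => toLex (Wof s σ v)) = σ := by
  symm
  rw [Tuple.eq_sort_iff]
  constructor
  · intro i j hij
    rcases hij.lt_or_eq with hij | rfl
    swap
    · exact le_rfl
    simp only [Function.comp, Wof, Equiv.symm_apply_apply, Prod.Lex.le_iff]
    rcases (h.1 hij.le).lt_or_eq with h1 | h1
    · left; exact h1
    · right
      refine ⟨h1, ?_⟩
      have := h.2 i j hij h1
      simp only [ofLex_toLex]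
      by_cases hi : i < σ i
      · simp [hi]
      · by_cases hj : j < σ j
        · simp [bkey, hi, hj] at this
          omega
        · simp [hi, hj]
  · intro i j hij heq
    simp only [Wof, Equiv.symm_apply_apply, EmbeddingLike.apply_eq_iff_eq, Prod.mk.injEq, decide_eq_decide] at heq
    have := h.2 i j hij heq.1
    simp only [bkey] at this
    have h2 := heq.2
    rw [Fin.lt_def]
    split_ifs at this <;> omega

lemma strict_up {n : ℕ} (σ : Equiv.Perm (Fin n)) (a b : Fin n) (hab : a ≤ b)
    (h : ∀ i j, a ≤ i → i < j → j ≤ b → σ i < σ j) : (σ a : ℕ) + (b - a) ≤ σ b := by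
  obtain ⟨d, hd⟩ : ∃ d, (b : ℕ) = a + d := ⟨b - a, by have := Fin.le_def.1 hab; omega⟩
  induction d generalizing b with
  | zero =>
    have : a = b := Fin.ext (by omega)
    subst this; simp
  | succ d ih =>
    have hb := b.2
    let c : Fin n := ⟨a + d, by omega⟩
    have hc : c < b := by rw [Fin.lt_def]; simp [c]; omega
    have := ih c (by rw [Fin.le_def]; simp [c]) (fun i j h1 h2 h3 => h i j h1 h2 (h3.trans hc.le)) rfl
    have h2 := Fin.lt_def.1 (h c b (by rw [Fin.le_def]; simp [c]) hc le_rfl)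
    simp only [c] at this h2
    omega

lemma sort_valid {n N : ℕ} (s : Fin n → Fin N) (hs : Monotone s) (W : Fin n → Fin N × Bool)
    (hc : cont (fun v => (W v).1) = cont s) (hok : ∀ v, okW s v (W v)) (σ : Equiv.Perm (Fin n))
    (hσ : σ = Tuple.sort (fun v => toLex (W v))) : compat σ s ∧ Wof s σ = W := by
  rw [Tuple.eq_sort_iff] at hσ
  obtain ⟨hmono, htie⟩ := hσ
  simp only [EmbeddingLike.apply_eq_iff_eq] at htie
  have hle : ∀ i j, i ≤ j → (W (σ i)).1 < (W (σ j)).1 ∨ (W (σ i)).1 = (W (σ j)).1 ∧ ((W (σ j)).2 = false → (W (σ i)).2 = false) := by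
    intro i j hij
    have := hmono hij
    simp only [Function.comp, Prod.Lex.le_iff, ofLex_toLex] at this
    refine this.imp id fun h => ⟨h.1, fun h' => ?_⟩
    have h2 := h.2
    rw [h'] at h2
    exact le_antisymm h2 (Bool.false_le _)
  have hfst : ∀ i, (W (σ i)).1 = s i := by
    have : (fun i => (W (σ i)).1) = s := by
      apply cont_inj _ _ _ hs
      · rw [← hc]; exact cont_comp_perm (fun v => (W v).1) σ
      · intro i j hij
        rcases hle i j hij with h | h
        · exact h.le
        · exact h.1.le
    exact fun i => congrFun this i
  have hex : ∀ i, (W (σ i)).2 = decide (¬ i < σ i) := by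
    intro i
    cases hb : (W (σ i)).2 with
    | false =>
      symm
      rw [decide_eq_false_iff_not, not_not]
      have hne : (univ.filter (fun v => s v = s i)).Nonempty := ⟨i, by simp⟩
      set a := (univ.filter (fun v => s v = s i)).min' hne with ha
      have hsa : s a = s i := by simpa using Finset.min'_mem _ hne
      have hmin : ∀ v, s v = s i → a ≤ v := fun v hv => Finset.min'_le _ _ (by simp [hv])
      have hai : a ≤ i := hmin i rfl
      have hW : ∀ c, a ≤ c → c ≤ i → W (σ c) = (s i, false) := by
        intro c h1 h2
        have hsc : s c = s i := le_antisymm (hs h2) (hsa ▸ hs h1)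
        have : (W (σ c)).2 = false := by
          rcases hle c i h2 with h | h
          · rw [hfst, hfst, hsc] at h; exact absurd h (lt_irrefl _)
          · exact h.2 hb
        ext1
        · simp [hfst, hsc]
        · simp [this]
      have hup := strict_up σ a i hai (fun c d h1 h2 h3 => htie c d h2 (by rw [hW c h1 (h2.le.trans h3), hW d (h1.trans h2.le) h3]))
      have hoka := (hok (σ a)).2 (by rw [hW a le_rfl hai])
      rw [hW a le_rfl hai] at hoka
      simp only at hoka
      have : a < σ a := by
        rcases hoka.1.lt_or_eq with h | h
        · by_contra h'
          have := hs (not_lt.1 h')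
          rw [hsa] at this
          exact absurd (h.trans_le this) (lt_irrefl _)
        · obtain ⟨u, hu, hu'⟩ := hoka.2 h
          exact (hmin u (hu'.trans h.symm)).trans_lt hu
      rw [Fin.lt_def] at this ⊢
      have := Fin.le_def.1 hai
      omega
    | true =>
      symm
      rw [decide_eq_true_iff, not_lt]
      have hne : (univ.filter (fun v => s v = s i)).Nonempty := ⟨i, by simp⟩
      set a := (univ.filter (fun v => s v = s i)).max' hne with ha
      have hsa : s a = s i := by simpa using Finset.max'_mem _ hne
      have hmax : ∀ v, s v = s i → v ≤ a := fun v hv => Finset.le_max' _ _ (by simp [hv])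
      have hai : i ≤ a := hmax i rfl
      have hW : ∀ c, i ≤ c → c ≤ a → W (σ c) = (s i, true) := by
        intro c h1 h2
        have hsc : s c = s i := le_antisymm (hsa ▸ hs h2) (hs h1)
        have : (W (σ c)).2 = true := by
          rcases hle i c h1 with h | h
          · rw [hfst, hfst, hsc] at h; exact absurd h (lt_irrefl _)
          · by_contra h'
            have := h.2 (by simpa using h')
            rw [hb] at this
            exact absurd this (by decide)
        ext1
        · simp [hfst, hsc]
        · simp [this]
      have hup := strict_up σ i a hai (fun c d h1 h2 h3 => htie c d h2 (by rw [hW c h1 (h2.le.trans h3), hW d (h1.trans h2.le) h3]))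
      have hoka := (hok (σ a)).1 (by rw [hW a hai le_rfl])
      rw [hW a hai le_rfl] at hoka
      simp only at hoka
      have : σ a ≤ a := by
        rcases hoka.lt_or_eq with h | h
        · by_contra h'
          have := hs (not_le.1 h').le
          rw [hsa] at this
          exact absurd (h.trans_le this) (lt_irrefl _)
        · exact hmax _ h
      rw [Fin.le_def] at this ⊢
      have := Fin.le_def.1 hai
      omega
  constructor
  · refine ⟨hs, fun i j hij hsij => ?_⟩
    have h1 := hle i j hij.le
    rw [hfst, hfst, hex, hex, hsij] at h1
    have h1 : decide (¬ j < σ j) = false → decide (¬ i < σ i) = false := by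
      rcases h1 with h | h
      · exact absurd h (lt_irrefl _)
      · exact h.2
    have h2 : decide (¬ i < σ i) = decide (¬ j < σ j) → σ i < σ j := fun h => htie i j hij (by
      ext1
      · simp [hfst, hsij]
      · rw [hex, hex, h])
    simp only [bkey]
    by_cases hi : i < σ i <;> by_cases hj : j < σ j <;> simp [hi, hj] at h1 h2 ⊢
    · exact h2
    · omega
    · exact h2
  · funext v
    obtain ⟨i, rfl⟩ := σ.surjective v
    ext1
    · simp [Wof, hfst]
    · simp [Wof, hex]

open Classical in
lemma core_sum {R : Type*} [CommRing R] {n N : ℕ} (t : R) (s : Fin n → Fin N) (hs : Monotone s) :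
    ∑ σ : Equiv.Perm (Fin n) with compat σ s, t ^ (univ.filter (fun i => i < σ i)).card =
    ∑ W : Fin n → Fin N × Bool with cont (fun v => (W v).1) = cont s,
      ∏ v, (if okW s v (W v) then (if (W v).2 = true then 1 else t) else 0) := by
  have : ∑ W : Fin n → Fin N × Bool with cont (fun v => (W v).1) = cont s,
      ∏ v, (if okW s v (W v) then (if (W v).2 = true then 1 else t) else 0) =
      ∑ W : Fin n → Fin N × Bool with (cont (fun v => (W v).1) = cont s ∧ ∀ v, okW s v (W v)),
      ∏ v, (if (W v).2 = true then 1 else t) := by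
    rw [← Finset.filter_filter, Finset.sum_filter (p := fun W : Fin n → Fin N × Bool => ∀ v, okW s v (W v))]
    refine Finset.sum_congr rfl fun W _ => ?_
    split_ifs with h
    · exact Finset.prod_congr rfl fun v _ => by rw [if_pos (h v)]
    · push Not at h
      obtain ⟨v, hv⟩ := h
      exact Finset.prod_eq_zero (Finset.mem_univ v) (by rw [if_neg hv])
  rw [this]
  refine Finset.sum_bij' (fun σ _ => Wof s σ) (fun W _ => Tuple.sort (fun v => toLex (W v))) ?_ ?_ ?_ ?_ ?_
  · intro σ _
    simp only [Finset.mem_filter, Finset.mem_univ, true_and]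
    exact ⟨Wof_cont s σ, Wof_ok s hs σ⟩
  · intro W hW
    simp only [Finset.mem_filter, Finset.mem_univ, true_and] at hW ⊢
    exact (sort_valid s hs W hW.1 hW.2 _ rfl).1
  · intro σ hσ
    simp only [Finset.mem_filter, Finset.mem_univ, true_and] at hσ
    exact sort_Wof s σ hσ
  · intro W hW
    simp only [Finset.mem_filter, Finset.mem_univ, true_and] at hW
    exact (sort_valid s hs W hW.1 hW.2 _ rfl).2
  · intro σ _
    rw [← Equiv.prod_comp σ]
    simp only [Wof, Equiv.symm_apply_apply]
    rw [← Finset.prod_const, Finset.prod_filter]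
    refine Finset.prod_congr rfl fun i _ => ?_
    by_cases h : i < σ i
    · simp [h]
    · simp [h, not_lt.1 h]

open Classical in
lemma lin_form {R : Type*} [CommRing R] {n N : ℕ} (t : R) (s : Fin n → Fin N) (v : Fin n) :
    (∑ x : Fin N × Bool, MvPolynomial.C (if okW s v x then (if x.2 = true then 1 else t) else 0) * MvPolynomial.X x.1 : MvPolynomial (Fin N) R)
    = if ∃ u, u < v ∧ s u = s v then Lp t (s v) else Lp t (s v) - MvPolynomial.C t * MvPolynomial.X (s v) := by
  rw [Fintype.sum_prod_type]
  simp only [Fintype.sum_bool, okW]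
  by_cases h : ∃ u, u < v ∧ s u = s v
  · rw [if_pos h]
    unfold Lp
    refine Finset.sum_congr rfl fun k _ => ?_
    simp only [h, ← add_mul, ← map_add]
    congr 2
    simp [add_comm]
  · rw [if_neg h, Lp_sub_t]
    unfold Mp
    refine Finset.sum_congr rfl fun k _ => ?_
    simp only [h, ← add_mul, ← map_add]
    congr 2
    rcases lt_trichotomy k (s v) with h | h | h
    · simp [not_le.2 h, h.ne, h, h.le]
    · simp [h]
    · simp [h.le, not_le.2 h, not_lt.2 h.le]

open Classical in
lemma fiber_prod {R : Type*} [CommRing R] {n N : ℕ} (t : R) (s : Fin n → Fin N) :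
    (∏ v, if ∃ u, u < v ∧ s u = s v then Lp t (s v) else Lp t (s v) - MvPolynomial.C t * MvPolynomial.X (s v) : MvPolynomial (Fin N) R) = ∏ j, gp t t j (cont s j) := by
  rw [← Finset.prod_fiberwise_of_maps_to (g := s) (t := univ) (fun _ _ => Finset.mem_univ _)]
  refine Finset.prod_congr rfl fun j _ => ?_
  rw [cont_apply]
  by_cases hne : (univ.filter (fun v => s v = j)).Nonempty
  · set a := (univ.filter (fun v => s v = j)).min' hne with ha
    have hma := Finset.min'_mem _ hne
    have hsa : s a = j := by simpa using hma
    have hmin : ∀ v, s v = j → a ≤ v := fun v hv => Finset.min'_le _ _ (by simp [hv])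
    rw [← Finset.mul_prod_erase _ _ hma, ← ha]
    have h1 : ¬ ∃ u, u < a ∧ s u = s a := by
      rintro ⟨u, hu, hu'⟩
      exact absurd (hmin u (hu'.trans hsa)) (not_le.2 hu)
    rw [if_neg h1, hsa]
    have : ∀ v ∈ (univ.filter (fun v => s v = j)).erase a, (if ∃ u, u < v ∧ s u = s v then Lp t (s v) else Lp t (s v) - MvPolynomial.C t * MvPolynomial.X (s v) : MvPolynomial (Fin N) R) = Lp t j := by
      intro v hv
      simp only [Finset.mem_erase, Finset.mem_filter, Finset.mem_univ, true_and] at hv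
      rw [if_pos ⟨a, lt_of_le_of_ne (hmin v hv.2) (Ne.symm hv.1), hsa.trans hv.2.symm⟩, hv.2]
    rw [Finset.prod_congr rfl this, Finset.prod_const, Finset.card_erase_of_mem hma, gp, if_neg (Finset.card_ne_zero.2 hne)]
  · rw [Finset.not_nonempty_iff_eq_empty] at hne
    rw [hne]
    simp [gp]

open Classical in
lemma core_G {R : Type*} [CommRing R] {n N : ℕ} (t : R) (s : Fin n → Fin N) (hs : Monotone s) :
    Gc t t (cont s) = ∑ σ : Equiv.Perm (Fin n) with compat σ s, t ^ (univ.filter (fun i => i < σ i)).card := by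
  rw [core_sum t s hs, Gc, ← fiber_prod]
  rw [Finset.prod_congr rfl (fun v _ => (lin_form t s v).symm), Finset.prod_univ_sum, MvPolynomial.coeff_sum,
    Fintype.piFinset_univ, Finset.sum_filter]
  refine Finset.sum_congr rfl fun W _ => ?_
  rw [Finset.prod_mul_distrib, ← map_prod]
  have : (∏ v, MvPolynomial.X (W v).1 : MvPolynomial (Fin N) R) = MvPolynomial.monomial (cont (fun v => (W v).1)) 1 := by
    rw [cont, MvPolynomial.monomial_sum_one]
    rfl
  rw [this, MvPolynomial.coeff_C_mul, MvPolynomial.coeff_monomial]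
  split_ifs <;> simp

noncomputable def hN {R : Type*} [CommRing R] {N : ℕ} (y : Fin N → R) (n : ℕ) : R :=
  ∑ m ∈ finsuppAntidiag (univ : Finset (Fin N)) n, ∏ j, y j ^ m j

noncomputable def AN {R : Type*} [CommRing R] {N : ℕ} (t u : R) (y : Fin N → R) (n : ℕ) : R :=
  ∑ m ∈ finsuppAntidiag (univ : Finset (Fin N)) n, (∏ j, y j ^ m j) * Gc t u m

lemma conv_N {R : Type*} [CommRing R] {N : ℕ} (t u : R) (y : Fin N → R) (n : ℕ) :
    ∑ m ∈ finsuppAntidiag (univ : Finset (Fin N)) n, (∏ j, y j ^ m j) * Pc t m =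
    ∑ p ∈ HasAntidiagonal.antidiagonal n, u ^ p.1 * hN y p.1 * AN t u y p.2 := by
  simp only [Pc_eq t u, hN, AN, Finset.mul_sum, Finset.sum_mul]
  rw [Finset.sum_sigma', ]
  simp only [Finset.sum_sigma']
  refine Finset.sum_bij' (fun x _ => ⟨(∑ j, x.2.1 j, ∑ j, x.2.2 j), ⟨x.2.2, x.2.1⟩⟩) (fun x _ => ⟨x.2.2 + x.2.1, (x.2.2, x.2.1)⟩) ?_ ?_ ?_ ?_ ?_
  · rintro ⟨m, a, b⟩ h
    simp only [Finset.mem_sigma, HasAntidiagonal.mem_antidiagonal, Finset.mem_finsuppAntidiag] at h ⊢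
    obtain ⟨⟨h1, -⟩, rfl⟩ := h
    simp [← h1, Finset.sum_add_distrib]
  · rintro ⟨⟨i, k⟩, ⟨b, a⟩⟩ h
    simp only [Finset.mem_sigma, HasAntidiagonal.mem_antidiagonal, Finset.mem_finsuppAntidiag] at h ⊢
    obtain ⟨h1, ⟨h2, -⟩, ⟨h3, -⟩⟩ := h
    simp [Finset.sum_add_distrib, h2, h3, h1]
  · rintro ⟨m, a, b⟩ h
    simp only [Finset.mem_sigma, HasAntidiagonal.mem_antidiagonal] at h
    obtain ⟨-, rfl⟩ := h
    rfl
  · rintro ⟨⟨i, k⟩, ⟨b, a⟩⟩ h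
    simp only [Finset.mem_sigma, HasAntidiagonal.mem_antidiagonal, Finset.mem_finsuppAntidiag] at h ⊢
    obtain ⟨h1, ⟨h2, -⟩, ⟨h3, -⟩⟩ := h
    subst h2 h3
    rfl
  · rintro ⟨m, a, b⟩ h
    simp only [Finset.mem_sigma, HasAntidiagonal.mem_antidiagonal] at h
    obtain ⟨-, rfl⟩ := h
    simp only [Finsupp.add_apply, pow_add, Finset.prod_mul_distrib]
    ring

lemma AN_zero {R : Type*} [CommRing R] {N : ℕ} (t u : R) (y : Fin N → R) : AN t u y 0 = 1 := by
  simp [AN, Gc_zero]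

lemma AN_one {R : Type*} [CommRing R] [IsDomain R] {N : ℕ} (t : R) (y : Fin N → R) (n : ℕ) (hn : n ≠ 0) :
    AN t 1 y n = t * AN t t y n := by
  unfold AN
  rw [Finset.mul_sum]
  refine Finset.sum_congr rfl fun m hm => ?_
  rw [Gc_one]
  · ring
  · rintro rfl
    simp [Finset.mem_finsuppAntidiag] at hm
    exact hn hm.symm

lemma key_N {R : Type*} [CommRing R] [IsDomain R] {N : ℕ} (t : R) (y : Fin N → R) (n : ℕ) :
    ∑ p ∈ HasAntidiagonal.antidiagonal n, t ^ p.1 * (hN y p.1 * AN t t y p.2) =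
    ∑ p ∈ HasAntidiagonal.antidiagonal n, (if p.2 = 0 then 1 else t) * (hN y p.1 * AN t t y p.2) := by
  have h1 := conv_N t t y n
  have h2 := conv_N t 1 y n
  rw [h1] at h2
  simp only [mul_assoc] at h2
  rw [h2]
  refine Finset.sum_congr rfl fun p _ => ?_
  split_ifs with h
  · rw [h, AN_zero, AN_zero]; simp
  · rw [AN_one t y _ h]; ring

lemma sum_cont {R : Type*} [CommRing R] {N : ℕ} (y : Fin N → R) (n : ℕ) (F : (Fin N →₀ ℕ) → R) [DecidablePred (fun s : Fin n → Fin N => Monotone s)] :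
    ∑ m ∈ finsuppAntidiag (univ : Finset (Fin N)) n, (∏ j, y j ^ m j) * F m =
    ∑ s : Fin n → Fin N with Monotone s, (∏ v, y (s v)) * F (cont s) := by
  symm
  refine Finset.sum_bij (fun s _ => cont s) ?_ ?_ ?_ ?_
  · intro s _
    simp only [Finset.mem_finsuppAntidiag, Finset.subset_univ, and_true, cont_apply]
    rw [← Finset.card_eq_sum_card_fiberwise (fun _ _ => Finset.mem_coe.2 (Finset.mem_univ _))]
    simp
  · intro s hs s' hs' h
    exact cont_inj s s' (by simpa using hs) (by simpa using hs') h
  · intro m hm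
    simp only [Finset.mem_finsuppAntidiag] at hm
    obtain ⟨s, h1, h2⟩ := cont_surj m hm.1
    exact ⟨s, by simpa using h1, h2⟩
  · intro s _
    congr 1
    rw [← Finset.prod_fiberwise_of_maps_to (g := s) (t := univ) (fun _ _ => Finset.mem_univ _)]
    refine Finset.prod_congr rfl fun j _ => ?_
    rw [cont_apply, ← Finset.prod_const]
    refine Finset.prod_congr rfl fun v hv => ?_
    simp only [Finset.mem_filter] at hv
    rw [hv.2]

lemma compat_one {n N : ℕ} (s : Fin n → Fin N) : compat 1 s ↔ Monotone s := by
  refine ⟨fun h => h.1, fun h => ⟨h, fun i j hij _ => ?_⟩⟩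
  simp [bkey]
  exact hij

open Classical in
noncomputable def Eσ {R : Type*} [CommRing R] {n N : ℕ} (y : Fin N → R) (σ : Equiv.Perm (Fin n)) : R :=
  ∑ s : Fin n → Fin N with compat σ s, ∏ v, y (s v)

lemma hN_eq {R : Type*} [CommRing R] {N : ℕ} (y : Fin N → R) (n : ℕ) :
    hN y n = Eσ y (1 : Equiv.Perm (Fin n)) := by
  classical
  have := sum_cont y n (fun _ => 1)
  simp only [mul_one] at this
  rw [hN, this, Eσ]
  simp only [compat_one]

lemma AN_eq {R : Type*} [CommRing R] {N : ℕ} (t : R) (y : Fin N → R) (n : ℕ) :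
    AN t t y n = ∑ σ : Equiv.Perm (Fin n), t ^ (univ.filter (fun i => i < σ i)).card * Eσ y σ := by
  classical
  rw [AN, sum_cont]
  simp only [Eσ]
  have : ∀ s ∈ (univ.filter (fun s : Fin n → Fin N => Monotone s)), (∏ v, y (s v)) * Gc t t (cont s) =
    ∑ σ : Equiv.Perm (Fin n), if compat σ s then t ^ (univ.filter (fun i => i < σ i)).card * ∏ v, y (s v) else 0 := by
    intro s hs
    rw [core_G t s (by simpa using hs), Finset.mul_sum, Finset.sum_filter]
    refine Finset.sum_congr rfl fun σ _ => ?_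
    split_ifs <;> ring
  rw [Finset.sum_congr rfl this, Finset.sum_comm]
  refine Finset.sum_congr rfl fun σ _ => ?_
  rw [Finset.mul_sum, ← Finset.sum_filter, Finset.filter_filter]
  refine Finset.sum_congr ?_ fun _ _ => rfl
  ext s
  simp only [Finset.mem_filter, Finset.mem_univ, true_and]
  exact ⟨fun h => h.2, fun h => ⟨h.1, h⟩⟩

/-- pair form of compatibility -/
def pairF {n N : ℕ} (D : ℕ → Prop) (s : Fin n → Fin N) : Prop :=
  ∀ i j : Fin n, i < j → s i ≤ s j ∧ ((∃ k : ℕ, (i : ℕ) ≤ k ∧ k < j ∧ D k) → s i < s j)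

open Classical in
noncomputable def ED {R : Type*} [CommRing R] {N : ℕ} (y : Fin N → R) (n : ℕ) (D : ℕ → Prop) (hi : ℕ) : R :=
  ∑ s : Fin n → Fin N with (∀ v, (s v : ℕ) < hi) ∧ pairF D s, ∏ v, y (s v)

open Classical in
lemma pairF_snoc {n N : ℕ} (D : ℕ → Prop) (hi : ℕ) (s : Fin n → Fin N) (c : Fin N) :
    ((∀ v, ((Fin.snoc s c : Fin (n + 1) → Fin N) v : ℕ) < hi) ∧ pairF D (Fin.snoc s c : Fin (n + 1) → Fin N)) ↔
    ((c : ℕ) < hi ∧ ((∀ v, (s v : ℕ) < if 0 < n ∧ D (n - 1) then (c : ℕ) else c + 1) ∧ pairF D s)) := by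
  constructor
  · rintro ⟨h1, h2⟩
    refine ⟨by simpa using h1 (Fin.last n), fun v => ?_, fun i j hij => ?_⟩
    · have := h2 v.castSucc (Fin.last n) (Fin.castSucc_lt_last v)
      simp only [Fin.snoc_castSucc, Fin.snoc_last, Fin.val_castSucc, Fin.val_last] at this
      split_ifs with h
      · exact this.2 ⟨n - 1, by omega, by omega, h.2⟩
      · have := Fin.le_def.1 this.1
        omega
    · have := h2 i.castSucc j.castSucc (by simpa using hij)
      simpa using this
  · rintro ⟨h1, h2, h3⟩
    constructor
    · intro v
      refine Fin.lastCases (by simpa using h1) (fun v => ?_) v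
      have := h2 v
      simp only [Fin.snoc_castSucc]
      split_ifs at this <;> omega
    · intro i j hij
      revert hij
      refine Fin.lastCases (fun hij => ?_) (fun j hij => ?_) j
      · obtain ⟨i, rfl⟩ : ∃ i', i = Fin.castSucc i' := ⟨i.castPred hij.ne, by simp⟩
        simp only [Fin.snoc_castSucc, Fin.snoc_last, Fin.val_castSucc, Fin.val_last]
        have h4 := h2 i
        refine ⟨?_, ?_⟩
        · rw [Fin.le_def]; split_ifs at h4 <;> omega
        · rintro ⟨k, hk1, hk2, hk3⟩
          rw [Fin.lt_def]
          split_ifs at h4 with h5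
          · exact h4
          · have hkn : k ≠ n - 1 := by
              rintro rfl; exact h5 ⟨by omega, hk3⟩
            have h6 := (h3 i ⟨n - 1, by omega⟩ (by rw [Fin.lt_def]; simp; omega)).2 ⟨k, hk1, by simp; omega, hk3⟩
            have h7 := h2 ⟨n - 1, by omega⟩
            rw [if_neg h5] at h7
            rw [Fin.lt_def] at h6
            omega
      · obtain ⟨i, rfl⟩ : ∃ i', i = Fin.castSucc i' := ⟨i.castPred (hij.trans (Fin.castSucc_lt_last j)).ne, by simp⟩
        have := h3 i j (by simpa using hij)
        simpa using this

open Classical in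
lemma ED_succ {R : Type*} [CommRing R] {N : ℕ} (y : Fin N → R) (n : ℕ) (D : ℕ → Prop) (hi : ℕ) :
    ED y (n + 1) D hi = ∑ c ∈ univ.filter (fun c : Fin N => (c : ℕ) < hi), y c * ED y n D (if 0 < n ∧ D (n - 1) then (c : ℕ) else c + 1) := by
  simp only [ED]
  rw [Finset.sum_filter, ← Equiv.sum_comp (Fin.snocEquiv (fun _ => Fin N)), Fintype.sum_prod_type, Finset.sum_filter]
  refine Finset.sum_congr rfl fun c _ => ?_
  simp only [Fin.snocEquiv, Equiv.coe_fn_mk, pairF_snoc]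
  by_cases hc : (c : ℕ) < hi
  · simp only [hc, true_and, if_true, Finset.mul_sum]
    rw [Finset.sum_filter]
    refine Finset.sum_congr rfl fun s _ => ?_
    congr 1
    rw [Fin.prod_univ_castSucc]
    simp [mul_comm]
  · simp [hc]

lemma geom_N {R : Type*} [CommRing R] (q : R) (N n hi : ℕ) (h : hi ≤ N) :
    q ^ N ∣ (1 - q ^ (n + 1)) * (∑ c ∈ univ.filter (fun c : Fin N => (c : ℕ) < hi), (q ^ (n + 1)) ^ (N - 1 - (c : ℕ))) - q ^ ((n + 1) * (N - hi)) := by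
  have h1 : (∑ c ∈ univ.filter (fun c : Fin N => (c : ℕ) < hi), (q ^ (n + 1)) ^ (N - 1 - (c : ℕ))) = ∑ c ∈ range hi, (q ^ (n + 1)) ^ (N - 1 - c) := by
    rw [Finset.sum_filter, Fin.sum_univ_eq_sum_range (fun c => if c < hi then (q ^ (n + 1)) ^ (N - 1 - c) else 0), ← Finset.sum_filter]
    congr 1
    ext c; simp; omega
  have h2 : ∀ hi ≤ N, (1 - q ^ (n + 1)) * ∑ c ∈ range hi, (q ^ (n + 1)) ^ (N - 1 - c) = (q ^ (n + 1)) ^ (N - hi) - (q ^ (n + 1)) ^ N := by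
    intro hi
    induction hi with
    | zero => simp
    | succ k ih =>
      intro hk
      rw [Finset.sum_range_succ, mul_add, ih (by omega), show N - k = N - 1 - k + 1 by omega, show N - (k + 1) = N - 1 - k by omega]
      ring
  rw [h1, h2 hi h, pow_mul]
  ring_nf
  rw [dvd_neg]
  exact Dvd.intro (q ^ (n * N)) (by ring)

open Classical in
lemma ED_mod {R : Type*} [CommRing R] (q : R) (N : ℕ) (D : ℕ → Prop) (n hi : ℕ) (h : hi ≤ N) :
    q ^ N ∣ (∏ i ∈ range n, (1 - q ^ (i + 1))) * ED (fun k : Fin N => q ^ (N - 1 - (k : ℕ))) n D hi -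
      q ^ (n * (N - hi) + ∑ i ∈ range (n - 1) with D i, (i + 1)) := by
  induction n generalizing hi with
  | zero =>
    simp [ED, pairF]
  | succ n ih =>
    rw [ED_succ, Finset.prod_range_succ]
    set e : ℕ := if 0 < n ∧ D (n - 1) then n else 0 with he
    set T : ℕ := ∑ i ∈ range (n - 1) with D i, (i + 1) with hT
    have hsum : ∑ i ∈ range (n + 1 - 1) with D i, (i + 1) = T + e := by
      rcases Nat.eq_zero_or_pos n with rfl | hn
      · simp [hT, he]
      · obtain ⟨k, rfl⟩ : ∃ k, n = k + 1 := ⟨n - 1, by omega⟩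
        simp only [hT, he, Finset.sum_filter]
        simp [Finset.sum_range_succ]
    rw [hsum]
    have h1 : q ^ N ∣ (1 - q ^ (n + 1)) * (∑ c ∈ univ.filter (fun c : Fin N => (c : ℕ) < hi), q ^ (N - 1 - (c : ℕ)) * ((∏ i ∈ range n, (1 - q ^ (i + 1))) * ED (fun k : Fin N => q ^ (N - 1 - (k : ℕ))) n D (if 0 < n ∧ D (n - 1) then (c : ℕ) else c + 1))) -
       (1 - q ^ (n + 1)) * (∑ c ∈ univ.filter (fun c : Fin N => (c : ℕ) < hi), q ^ (N - 1 - (c : ℕ)) * q ^ (n * (N - 1 - (c : ℕ)) + e + T)) := by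
      rw [← mul_sub, ← Finset.sum_sub_distrib]
      apply Dvd.dvd.mul_left
      refine Finset.dvd_sum fun c _ => ?_
      rw [← mul_sub]
      apply Dvd.dvd.mul_left
      have hcN := c.2
      have := ih (if 0 < n ∧ D (n - 1) then (c : ℕ) else c + 1) (by split_ifs <;> omega)
      convert this using 4
      rw [he]
      split_ifs
      · rw [show N - (c : ℕ) = N - 1 - c + 1 by omega]; ring
      · rw [show N - 1 - (c : ℕ) = N - (c + 1) by omega]; ring
    have h2 : q ^ N ∣ (1 - q ^ (n + 1)) * (∑ c ∈ univ.filter (fun c : Fin N => (c : ℕ) < hi), q ^ (N - 1 - (c : ℕ)) * q ^ (n * (N - 1 - (c : ℕ)) + e + T)) - q ^ ((n + 1) * (N - hi) + (T + e)) := by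
      have := (geom_N q N n hi h).mul_right (q ^ (T + e))
      convert this using 1
      conv_rhs => rw [sub_mul, mul_assoc, Finset.sum_mul, ← pow_add]
      congr 2
      refine Finset.sum_congr rfl fun c _ => ?_
      rw [← pow_mul, ← pow_add, ← pow_add]
      congr 1; ring
    have h3 := dvd_add h1 h2
    convert h3 using 1
    simp only [Finset.mul_sum]
    rw [sub_add_sub_cancel]
    congr 1
    refine Finset.sum_congr rfl fun c _ => ?_
    ring

def Dσ {n : ℕ} (σ : Equiv.Perm (Fin n)) (i : ℕ) : Prop :=
  ∃ h : i + 1 < n, bkey σ ⟨i + 1, h⟩ < bkey σ ⟨i, by omega⟩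

lemma bkey_inj {n : ℕ} (σ : Equiv.Perm (Fin n)) (i j : Fin n) (h : bkey σ i = bkey σ j) : i = j := by
  have h1 := (σ i).2
  have h2 := (σ j).2
  simp only [bkey] at h
  apply σ.injective
  apply Fin.ext
  split_ifs at h <;> omega

lemma compat_iff {n N : ℕ} (σ : Equiv.Perm (Fin n)) (s : Fin n → Fin N) :
    compat σ s ↔ (∀ v, (s v : ℕ) < N) ∧ pairF (Dσ σ) s := by
  constructor
  · rintro ⟨h1, h2⟩
    refine ⟨fun v => (s v).2, fun i j hij => ⟨h1 hij.le, ?_⟩⟩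
    rintro ⟨k, hik, hkj, hk, hlt⟩
    refine lt_of_le_of_ne (h1 hij.le) fun heq => ?_
    have a1 : s i ≤ s ⟨k, by omega⟩ := h1 (Fin.le_def.2 hik)
    have a2 : s ⟨k, by omega⟩ ≤ s ⟨k + 1, hk⟩ := h1 (Fin.le_def.2 (by simp))
    have a3 : s ⟨k + 1, hk⟩ ≤ s j := h1 (Fin.le_def.2 (by simp; omega))
    have a4 : s ⟨k, by omega⟩ = s ⟨k + 1, hk⟩ := le_antisymm a2 (a3.trans (heq ▸ a1))
    have := h2 ⟨k, by omega⟩ ⟨k + 1, hk⟩ (by simp) a4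
    omega
  · rintro ⟨-, h⟩
    refine ⟨fun i j hij => ?_, fun i j hij heq => ?_⟩
    · rcases hij.lt_or_eq with h' | rfl
      · exact (h i j h').1
      · exact le_rfl
    · have hD : ∀ k, (i : ℕ) ≤ k → k < j → ¬ Dσ σ k := fun k h1 h2 h3 => (((h i j hij).2 ⟨k, h1, h2, h3⟩).ne heq)
      have : ∀ d, ∀ (hd : (i : ℕ) + d + 1 ≤ j), bkey σ i < bkey σ ⟨i + d + 1, by omega⟩ := by
        intro d
        induction d with
        | zero =>
          intro hd
          have h1 := hD i le_rfl (by omega)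
          simp only [Dσ, not_exists, not_lt] at h1
          have h2 := h1 (by omega)
          refine lt_of_le_of_ne h2 fun h3 => ?_
          have := congrArg Fin.val (bkey_inj σ _ _ h3)
          simp at this
        | succ d ih =>
          intro hd
          refine (ih (by omega)).trans ?_
          have h1 := hD (i + d + 1) (by omega) (by omega)
          simp only [Dσ, not_exists, not_lt] at h1
          have h2 := h1 (by omega)
          refine lt_of_le_of_ne h2 fun h3 => ?_
          have := congrArg Fin.val (bkey_inj σ _ _ h3)
          simp at this
      have h2 := this (j - i - 1) (by omega)
      have h3 : (⟨i + (j - i - 1) + 1, by omega⟩ : Fin n) = j := Fin.ext (by simp; omega)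
      rwa [h3] at h2

open Classical in
lemma Eσ_mod {R : Type*} [CommRing R] (q : R) (N : ℕ) {n : ℕ} (σ : Equiv.Perm (Fin n)) :
    q ^ N ∣ (∏ i ∈ range n, (1 - q ^ (i + 1))) * Eσ (fun k : Fin N => q ^ (N - 1 - (k : ℕ))) σ -
      q ^ (∑ i ∈ range (n - 1) with Dσ σ i, (i + 1)) := by
  have := ED_mod q N (Dσ σ) n N le_rfl
  simp only [Nat.sub_self, mul_zero, zero_add] at this
  have h : Eσ (fun k : Fin N => q ^ (N - 1 - (k : ℕ))) σ = ED (fun k : Fin N => q ^ (N - 1 - (k : ℕ))) n (Dσ σ) N := by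
    unfold Eσ ED
    simp only [compat_iff]
  rw [h]
  exact this

lemma D_one {n : ℕ} (i : ℕ) : ¬ Dσ (1 : Equiv.Perm (Fin n)) i := by
  rintro ⟨h, h2⟩
  simp [bkey] at h2

lemma excN_eq {n : ℕ} (σ : Equiv.Perm (Fin n)) : excN σ = (univ.filter (fun i => i < σ i)).card := by
  unfold excN
  rw [Finset.card_filter, Finset.card_filter, ← Fin.sum_univ_eq_sum_range (fun i => if i < pf σ i then 1 else 0)]
  refine Finset.sum_congr rfl fun i _ => ?_
  simp only [pf, i.2, dite_true, Fin.lt_def]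

open Classical in
lemma majN_eq {n : ℕ} (σ : Equiv.Perm (Fin n)) :
    majN σ = ∑ i ∈ range (n - 1) with Dσ σ i, (i + 1) + excN σ := by
  have key : ∀ k, k ≤ n - 1 → ∑ i ∈ range k, (if pf σ (i + 1) < pf σ i then i + 1 else 0) + k * (if k < pf σ k then 1 else 0) =
     ∑ i ∈ range k, (if Dσ σ i then i + 1 else 0) + ∑ i ∈ range k, (if i < pf σ i then 1 else 0) := by
    intro k
    induction k with
    | zero => simp
    | succ k ih =>
      intro hk
      have ih := ih (by omega)
      rw [Finset.sum_range_succ, Finset.sum_range_succ, Finset.sum_range_succ]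
      have h0 : k < n := by omega
      have h1 : k + 1 < n := by omega
      have hne : σ ⟨k, h0⟩ ≠ σ ⟨k + 1, h1⟩ := fun h => by
        have := congrArg Fin.val (σ.injective h)
        simp at this
      have hne' : (σ ⟨k, h0⟩ : ℕ) ≠ σ ⟨k + 1, h1⟩ := fun h => hne (Fin.ext h)
      have hD : Dσ σ k ↔ bkey σ ⟨k + 1, h1⟩ < bkey σ ⟨k, h0⟩ := ⟨fun h => h.2, fun h => ⟨h1, h⟩⟩
      have p0 : pf σ k = σ ⟨k, h0⟩ := by simp [pf, h0]
      have p1 : pf σ (k + 1) = σ ⟨k + 1, h1⟩ := by simp [pf, h1]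
      have b0 := (σ ⟨k, h0⟩).2
      have b1 := (σ ⟨k + 1, h1⟩).2
      simp only [bkey, Fin.lt_def] at hD
      rw [p0] at ih
      simp only [p0, p1, hD]
      generalize (σ ⟨k, h0⟩ : ℕ) = a at *
      generalize (σ ⟨k + 1, h1⟩ : ℕ) = b at *
      by_cases ha : k < a <;> by_cases hb : k + 1 < b <;> by_cases hab : b < a <;>
        simp only [ha, hb, hab, if_true, if_false] at ih ⊢ <;> (try split_ifs) <;> omega
  rcases Nat.eq_zero_or_pos n with rfl | hn
  · simp [majN, excN]
  have := key (n - 1) le_rfl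
  have hlast : ¬ (n - 1 < pf σ (n - 1)) := by
    have : n - 1 < n := by omega
    simp only [pf, this, dite_true]
    have := (σ ⟨n - 1, this⟩).2
    omega
  rw [if_neg hlast, mul_zero, add_zero] at this
  unfold majN
  rw [Finset.sum_filter, this, Finset.sum_filter]
  congr 1
  unfold excN
  rw [Finset.card_filter, show range n = range (n - 1 + 1) by rw [Nat.sub_add_cancel hn], Finset.sum_range_succ, if_neg hlast, add_zero]

open Classical in
lemma Aq_eq {R : Type*} [CommRing R] (t q : R) (n : ℕ) :
    Aq R n t q = ∑ σ : Equiv.Perm (Fin n), t ^ (univ.filter (fun i => i < σ i)).card * q ^ (∑ i ∈ range (n - 1) with Dσ σ i, (i + 1)) := by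
  unfold Aq
  refine Finset.sum_congr rfl fun σ _ => ?_
  rw [majN_eq, Nat.add_sub_cancel, excN_eq]

lemma AN_mod {R : Type*} [CommRing R] (t q : R) (N n : ℕ) :
    q ^ N ∣ (∏ i ∈ range n, (1 - q ^ (i + 1))) * AN t t (fun k : Fin N => q ^ (N - 1 - (k : ℕ))) n - Aq R n t q := by
  classical
  rw [AN_eq, Aq_eq, Finset.mul_sum, ← Finset.sum_sub_distrib]
  refine Finset.dvd_sum fun σ _ => ?_
  have := (Eσ_mod q N σ).mul_left (t ^ (univ.filter (fun i => i < σ i)).card)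
  convert this using 1
  ring

lemma hN_mod {R : Type*} [CommRing R] (q : R) (N n : ℕ) :
    q ^ N ∣ (∏ i ∈ range n, (1 - q ^ (i + 1))) * hN (fun k : Fin N => q ^ (N - 1 - (k : ℕ))) n - 1 := by
  classical
  rw [hN_eq]
  have := Eσ_mod q N (1 : Equiv.Perm (Fin n))
  simpa [D_one] using this

lemma gaussR_zero_of_lt {R : Type*} [CommRing R] (q : R) (n k : ℕ) (h : n < k) : gaussR q n k = 0 := by
  induction n generalizing k with
  | zero =>
    obtain ⟨k, rfl⟩ : ∃ j, k = j + 1 := ⟨k - 1, by omega⟩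
    simp [gaussR]
  | succ n ih =>
    obtain ⟨k, rfl⟩ : ∃ j, k = j + 1 := ⟨k - 1, by omega⟩
    simp [gaussR, ih k (by omega), ih (k + 1) (by omega)]

lemma gaussR_zero {R : Type*} [CommRing R] (q : R) (n : ℕ) : gaussR q n 0 = 1 := by
  cases n <;> simp [gaussR]

lemma gaussR_self {R : Type*} [CommRing R] (q : R) (n : ℕ) : gaussR q n n = 1 := by
  induction n with
  | zero => simp [gaussR]
  | succ n ih => simp [gaussR, ih, gaussR_zero_of_lt q n (n + 1) (by omega)]

lemma gaussR_fact {R : Type*} [CommRing R] (q : R) (a b : ℕ) :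
    gaussR q (a + b) b * ((∏ i ∈ range a, (1 - q ^ (i + 1))) * ∏ i ∈ range b, (1 - q ^ (i + 1))) =
      ∏ i ∈ range (a + b), (1 - q ^ (i + 1)) := by
  induction h : a + b generalizing a b with
  | zero =>
    obtain ⟨rfl, rfl⟩ : a = 0 ∧ b = 0 := by omega
    simp [gaussR]
  | succ n ih =>
    rcases Nat.eq_zero_or_pos b with rfl | hb
    · obtain rfl : a = n + 1 := by omega
      simp [gaussR]
    rcases Nat.eq_zero_or_pos a with rfl | ha
    · obtain rfl : b = n + 1 := by omega
      simp [gaussR_self]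
    obtain ⟨a, rfl⟩ : ∃ j, a = j + 1 := ⟨a - 1, by omega⟩
    obtain ⟨b, rfl⟩ : ∃ j, b = j + 1 := ⟨b - 1, by omega⟩
    have h1 := ih (a + 1) b (by omega)
    have h2 := ih a (b + 1) (by omega)
    rw [gaussR, Finset.prod_range_succ _ n]
    rw [Finset.prod_range_succ] at h1 h2
    rw [Finset.prod_range_succ _ a, Finset.prod_range_succ _ b]
    have hn : n = a + b + 1 := by omega
    have : (1 - q ^ (n + 1)) = (1 - q ^ (b + 1)) + q ^ (b + 1) * (1 - q ^ (a + 1)) := by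
      rw [hn]; ring
    rw [this, mul_add]
    nth_rewrite 1 [← h1]
    rw [← h2]
    ring

lemma star {R : Type*} [CommRing R] [IsDomain R] (t q : R) (hq : ∀ x : R, (∀ N : ℕ, q ^ N ∣ x) → x = 0) (n : ℕ) :
    ∑ p ∈ HasAntidiagonal.antidiagonal n, t ^ p.1 * (gaussR q n p.2 * Aq R p.2 t q) =
    ∑ p ∈ HasAntidiagonal.antidiagonal n, (if p.2 = 0 then 1 else t) * (gaussR q n p.2 * Aq R p.2 t q) := by
  rw [← sub_eq_zero]
  apply hq
  intro N
  set y : Fin N → R := fun k : Fin N => q ^ (N - 1 - (k : ℕ)) with hy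
  have key := key_N t y n
  have main : ∀ (w : ℕ × ℕ → R), q ^ N ∣ (∏ i ∈ range n, (1 - q ^ (i + 1))) * ∑ p ∈ HasAntidiagonal.antidiagonal n, w p * (hN y p.1 * AN t t y p.2) - ∑ p ∈ HasAntidiagonal.antidiagonal n, w p * (gaussR q n p.2 * Aq R p.2 t q) := by
    intro w
    rw [Finset.mul_sum, ← Finset.sum_sub_distrib]
    refine Finset.dvd_sum fun p hp => ?_
    rw [HasAntidiagonal.mem_antidiagonal] at hp
    have hg := gaussR_fact q p.1 p.2
    rw [hp] at hg
    rw [← hg]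
    obtain ⟨c, hc⟩ := hN_mod q N p.1
    obtain ⟨d, hd⟩ := AN_mod t q N p.2
    rw [← hy] at hc hd
    rw [sub_eq_iff_eq_add] at hc hd
    have : (gaussR q n p.2 * ((∏ i ∈ range p.1, (1 - q ^ (i + 1))) * ∏ i ∈ range p.2, (1 - q ^ (i + 1)))) * (w p * (hN y p.1 * AN t t y p.2)) =
      w p * gaussR q n p.2 * (((∏ i ∈ range p.1, (1 - q ^ (i + 1))) * hN y p.1) * ((∏ i ∈ range p.2, (1 - q ^ (i + 1))) * AN t t y p.2)) := by ring
    rw [this, hc, hd]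
    refine ⟨w p * gaussR q n p.2 * (c * (q ^ N * d + Aq R p.2 t q) + d), ?_⟩
    ring
  have := dvd_sub (main (fun p => if p.2 = 0 then 1 else t)) (main (fun p => t ^ p.1))
  rw [key] at this
  simpa using this

lemma gaussR_map {R S : Type*} [CommRing R] [CommRing S] (f : R →+* S) (q : R) (n k : ℕ) :
    f (gaussR q n k) = gaussR (f q) n k := by
  induction n generalizing k with
  | zero => cases k <;> simp [gaussR]
  | succ n ih => cases k <;> simp [gaussR, ih]

lemma Aq_map {R S : Type*} [CommRing R] [CommRing S] (f : R →+* S) (t q : R) (n : ℕ) :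
    f (Aq R n t q) = Aq S n (f t) (f q) := by
  simp [Aq]

lemma Atilde_map {R S : Type*} [CommRing R] [CommRing S] (f : R →+* S) (t q : R) (n : ℕ) :
    f (Atilde R n t q) = Atilde S n (f t) (f q) := by
  simp [Atilde, Aq_map, gaussR_map]

lemma Aq_zero {R : Type*} [CommRing R] (t q : R) : Aq R 0 t q = 1 := by
  simp [Aq, excN, majN]

lemma sum_anti_Icc {R : Type*} [CommRing R] (F : ℕ → ℕ → R) (n : ℕ) :
    ∑ p ∈ HasAntidiagonal.antidiagonal n, F p.1 p.2 = F n 0 + ∑ k ∈ Icc 1 n, F (n - k) k := by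
  rw [← Finset.Nat.sum_antidiagonal_swap, Finset.Nat.sum_antidiagonal_eq_sum_range_succ_mk]
  rw [Finset.sum_range_succ', add_comm]
  simp only [Prod.swap, Nat.sub_zero]
  congr 1
  rw [Finset.range_eq_Ico, Finset.sum_Ico_add' (fun k => F (n - k) k) 0 n 1]
  rfl

lemma Atilde_anti {R : Type*} [CommRing R] (t q : R) (n : ℕ) :
    Atilde R n t q = ∑ p ∈ HasAntidiagonal.antidiagonal n, (if p.2 = 0 then 1 else t) * (gaussR q n p.2 * Aq R p.2 t q) := by
  rw [sum_anti_Icc (fun _ k => (if k = 0 then 1 else t) * (gaussR q n k * Aq R k t q))]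
  simp only [if_true, gaussR_zero, Aq_zero, Atilde, mul_one, Finset.mul_sum]
  congr 1
  refine Finset.sum_congr rfl fun k hk => ?_
  rw [if_neg (by have := (Finset.mem_Icc.1 hk).1; omega)]

def qf {F : Type*} [Field F] (q : F) (n : ℕ) : F := ∏ i ∈ range n, (1 - q ^ (i + 1))

lemma qf_conv {F : Type*} [Field F] (q : F) (h : ∀ n, qf q n ≠ 0) (n : ℕ) (p : ℕ × ℕ) (hp : p.1 + p.2 = n) :
    gaussR q n p.2 / qf q n = (1 / qf q p.1) * (1 / qf q p.2) := by
  have := gaussR_fact q p.1 p.2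
  rw [hp] at this
  change _ * (qf q p.1 * qf q p.2) = qf q n at this
  have h1 := h p.1
  have h2 := h p.2
  have h3 := h n
  field_simp
  linear_combination this

lemma field_rec {F : Type*} [Field F] (t q : F) (ht : t ≠ 1) (h : ∀ n, qf q n ≠ 0)
    (hs : ∀ n, ∑ p ∈ HasAntidiagonal.antidiagonal n, t ^ p.1 * (gaussR q n p.2 * Aq F p.2 t q) = Atilde F n t q) (n : ℕ) :
    Atilde F (n + 1) t q = Atilde F n t q + t * ∑ p ∈ HasAntidiagonal.antidiagonal n, gaussR q n p.2 * q ^ p.2 * Aq F p.2 t q * Atilde F p.1 t q := by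
  let e : PowerSeries F := PowerSeries.mk fun n => 1 / qf q n
  let f : PowerSeries F := PowerSeries.mk fun n => t ^ n / qf q n
  let a : PowerSeries F := PowerSeries.mk fun n => Aq F n t q / qf q n
  let w : PowerSeries F := PowerSeries.mk fun n => Atilde F n t q / qf q n
  let e1 : PowerSeries F := PowerSeries.mk fun n => q ^ n * (1 / qf q n)
  let f1 : PowerSeries F := PowerSeries.mk fun n => q ^ n * (t ^ n / qf q n)
  let a1 : PowerSeries F := PowerSeries.mk fun n => q ^ n * (Aq F n t q / qf q n)
  let w1 : PowerSeries F := PowerSeries.mk fun n => q ^ n * (Atilde F n t q / qf q n)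
  let T : PowerSeries F := PowerSeries.C t
  let z : PowerSeries F := PowerSeries.X
  have hq0 : qf q 0 = 1 := by simp [qf]
  have hqs : ∀ n, qf q (n + 1) = qf q n * (1 - q ^ (n + 1)) := fun n => by simp [qf, Finset.prod_range_succ]
  have hqn : ∀ n, (1 - q ^ (n + 1)) ≠ 0 := fun n h' => h (n + 1) (by rw [hqs, h', mul_zero])
  have re : PowerSeries.rescale q e = e1 := by ext n; simp [e, e1, PowerSeries.coeff_rescale]
  have rf : PowerSeries.rescale q f = f1 := by ext n; simp [f, f1, PowerSeries.coeff_rescale]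
  have ra : PowerSeries.rescale q a = a1 := by ext n; simp [a, a1, PowerSeries.coeff_rescale]
  have rw1 : PowerSeries.rescale q w = w1 := by ext n; simp [w, w1, PowerSeries.coeff_rescale]
  have rT : PowerSeries.rescale q T = T := by
    ext n
    simp only [PowerSeries.coeff_rescale, T, PowerSeries.coeff_C]
    split_ifs with h0 <;> simp [h0]
  have E1 : w = f * a := by
    ext n
    simp only [w, f, a, PowerSeries.coeff_mul, PowerSeries.coeff_mk]
    rw [← hs, Finset.sum_div]
    refine Finset.sum_congr rfl fun p hp => ?_
    have := qf_conv q h n p (HasAntidiagonal.mem_antidiagonal.1 hp)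
    linear_combination (t ^ p.1 * Aq F p.2 t q) * this
  have E2 : w = (1 - T) * e + T * (e * a) := by
    ext n
    simp only [sub_mul, one_mul, map_add, map_sub, T, PowerSeries.coeff_C_mul]
    rw [PowerSeries.coeff_mul]
    simp only [w, e, a, PowerSeries.coeff_mk]
    have : ∑ p ∈ HasAntidiagonal.antidiagonal n, 1 / qf q p.1 * (Aq F p.2 t q / qf q p.2) = ∑ p ∈ HasAntidiagonal.antidiagonal n, gaussR q n p.2 * Aq F p.2 t q / qf q n := by
      refine Finset.sum_congr rfl fun p hp => ?_
      have := qf_conv q h n p (HasAntidiagonal.mem_antidiagonal.1 hp)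
      linear_combination (-Aq F p.2 t q) * this
    rw [this, sum_anti_Icc (fun _ k => gaussR q n k * Aq F k t q / qf q n), Atilde, gaussR_zero, Aq_zero, ← Finset.sum_div]
    ring
  have E3 : w1 = f1 * a1 := by rw [← rw1, ← rf, ← ra, ← map_mul, ← E1]
  have E4 : w1 = (1 - T) * e1 + T * (e1 * a1) := by
    have h5 := congrArg (PowerSeries.rescale q) E2
    simpa only [map_add, map_sub, map_mul, map_one, re, ra, rT, rw1] using h5
  have He : e1 = (1 - z) * e := by
    ext n
    rw [sub_mul, one_mul, map_sub]
    cases n with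
    | zero => simp [e, e1, z]
    | succ n =>
      simp only [z, e, e1, PowerSeries.coeff_succ_X_mul, PowerSeries.coeff_mk, hqs]
      have := h n
      have := hqn n
      field_simp
      ring
  have Hf : f1 = (1 - T * z) * f := by
    ext n
    rw [sub_mul, one_mul, map_sub, mul_assoc]
    simp only [T, PowerSeries.coeff_C_mul]
    cases n with
    | zero => simp [f, f1, z]
    | succ n =>
      simp only [z, f, f1, PowerSeries.coeff_succ_X_mul, PowerSeries.coeff_mk, hqs]
      have := h n
      have := hqn n
      field_simp
      ring
  have N0 : (1 - T) ≠ 0 := by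
    intro h0
    have := congrArg (PowerSeries.constantCoeff (R := F)) h0
    simp [T, sub_eq_zero] at this
    exact ht this.symm
  have N1 : f - T * e ≠ 0 := by
    intro h0
    have := congrArg (PowerSeries.coeff (R := F) 0) h0
    simp [T, e, f, hq0, sub_eq_zero] at this
    exact ht this.symm
  have N2 : f1 - T * e1 ≠ 0 := by
    intro h0
    have := congrArg (PowerSeries.coeff (R := F) 0) h0
    simp [T, e1, f1, hq0, sub_eq_zero] at this
    exact ht this.symm
  have A1 : a * (f - T * e) = (1 - T) * e := by linear_combination E2 - E1
  have A2 : a1 * (f1 - T * e1) = (1 - T) * e1 := by linear_combination E4 - E3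
  have goal : w - w1 = z * (w * (1 + T * a1)) := by
    apply mul_right_cancel₀ (mul_ne_zero N1 N2)
    have W : w * (f - T * e) = (1 - T) * e * f := by rw [E1]; linear_combination f * A1
    have W1 : w1 * (f1 - T * e1) = (1 - T) * e1 * f1 := by rw [E3]; linear_combination f1 * A2
    have L : (w - w1) * ((f - T * e) * (f1 - T * e1)) = (1 - T) * e * f * (f1 - T * e1) - (1 - T) * e1 * f1 * (f - T * e) := by
      linear_combination (f1 - T * e1) * W - (f - T * e) * W1
    have Rr : z * (w * (1 + T * a1)) * ((f - T * e) * (f1 - T * e1)) = z * ((1 - T) * e * f) * ((f1 - T * e1) + T * (1 - T) * e1) := by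
      linear_combination z * ((f1 - T * e1) + T * a1 * (f1 - T * e1)) * W + z * ((1 - T) * e * f) * T * A2
    rw [L, Rr, He, Hf]
    ring
  have gc := congrArg (PowerSeries.coeff (R := F) (n + 1)) goal
  rw [map_sub, PowerSeries.coeff_succ_X_mul, mul_add, mul_one, map_add, mul_left_comm, PowerSeries.coeff_C_mul, PowerSeries.coeff_mul] at gc
  simp only [w, w1, a1, PowerSeries.coeff_mk] at gc
  have : ∑ p ∈ HasAntidiagonal.antidiagonal n, Atilde F p.1 t q / qf q p.1 * (q ^ p.2 * (Aq F p.2 t q / qf q p.2)) =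
      (∑ p ∈ HasAntidiagonal.antidiagonal n, gaussR q n p.2 * q ^ p.2 * Aq F p.2 t q * Atilde F p.1 t q) / qf q n := by
    rw [Finset.sum_div]
    refine Finset.sum_congr rfl fun p hp => ?_
    have := qf_conv q h n p (HasAntidiagonal.mem_antidiagonal.1 hp)
    linear_combination (-Aq F p.2 t q * q ^ p.2 * Atilde F p.1 t q) * this
  rw [this, hqs] at gc
  have h1 := h n
  have h2 := hqn n
  have k : ∀ x : F, x / (qf q n * (1 - q ^ (n + 1))) - q ^ (n + 1) * (x / (qf q n * (1 - q ^ (n + 1)))) = x / qf q n := by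
    intro x
    have : ∀ y : F, y - q ^ (n + 1) * y = y * (1 - q ^ (n + 1)) := fun y => by ring
    rw [this, ← div_div, div_mul_cancel₀ _ h2]
  rw [k, ← mul_div_assoc, ← add_div] at gc
  exact (div_left_inj' h1).1 gc

lemma poly_rec (n : ℕ) (t q : Polynomial (Polynomial ℤ)) (htd : t = Polynomial.C Polynomial.X) (hqd : q = Polynomial.X) :
    Atilde _ (n + 1) t q =
      (1 + t) * Atilde _ n t q +
        t * ∑ k ∈ Icc 1 n, gaussR q n k * q ^ k * Aq _ k t q * Atilde _ (n - k) t q := by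
  have hq : ∀ x : Polynomial (Polynomial ℤ), (∀ N : ℕ, q ^ N ∣ x) → x = 0 := by
    intro x hx
    ext1 d
    rw [Polynomial.coeff_zero]
    subst hqd
    exact Polynomial.X_pow_dvd_iff.1 (hx (d + 1)) d (Nat.lt_succ_self d)
  let ι : Polynomial (Polynomial ℤ) →+* FractionRing (Polynomial (Polynomial ℤ)) := algebraMap _ _
  have hι : Function.Injective ι := IsFractionRing.injective _ _
  have ht : ι t ≠ 1 := by
    intro h
    rw [← map_one ι] at h
    have := hι h
    rw [htd, ← Polynomial.C_1] at this
    exact Polynomial.X_ne_C (1 : ℤ) (by simpa using Polynomial.C_injective this)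
  have hqf : ∀ n, qf (ι q) n ≠ 0 := by
    intro n
    refine Finset.prod_ne_zero_iff.2 fun i _ h => ?_
    rw [← map_one ι, ← map_pow, ← map_sub, ← map_zero ι] at h
    have := congrArg (Polynomial.eval 0) (hι h)
    simp [hqd] at this
  have hs : ∀ n, ∑ p ∈ HasAntidiagonal.antidiagonal n, (ι t) ^ p.1 * (gaussR (ι q) n p.2 * Aq _ p.2 (ι t) (ι q)) = Atilde _ n (ι t) (ι q) := by
    intro n
    rw [← Atilde_map, Atilde_anti, ← star t q hq n]
    simp [Aq_map, gaussR_map]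
  have := field_rec (ι t) (ι q) ht hqf hs n
  apply hι
  rw [sum_anti_Icc (fun i k => gaussR (ι q) n k * (ι q) ^ k * Aq _ k (ι t) (ι q) * Atilde _ i (ι t) (ι q))] at this
  simp only [map_add, map_mul, map_sum, map_one, map_pow, Aq_map, gaussR_map, Atilde_map]
  rw [this]
  simp only [gaussR_zero, Aq_zero]
  ring

/-- the quadratic recurrence for the q-binomial-Eulerian polynomials. -/
theorem stmt8 {R : Type*} [CommRing R] (t q : R) (n : ℕ) :
    Atilde R (n + 1) t q =
      (1 + t) * Atilde R n t q +
        t * ∑ k ∈ Icc 1 n, gaussR q n k * q ^ k * Aq R k t q * Atilde R (n - k) t q := by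
  let φ : Polynomial (Polynomial ℤ) →+* R :=
    Polynomial.eval₂RingHom (Polynomial.eval₂RingHom (Int.castRingHom R) t) q
  have h1 : φ Polynomial.X = q := by simp [φ]
  have h2 : φ (Polynomial.C Polynomial.X) = t := by simp [φ]
  have := congrArg φ (poly_rec n _ _ rfl rfl)
  simpa only [map_add, map_mul, map_sum, map_one, map_pow, Aq_map, gaussR_map, Atilde_map, h1, h2] using this
end
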